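/- Let δ be a fixed real number and let ν, μ > 0 with |ν − μ| > 2. Then the positive zeros of the cylinder functions C_ν and C_μ are NOT interlaced on (0,∞). -/

import Mathlib

open Real Filter Topology Set

/-- Bessel function of the first kind of real order `ν`:
`J_ν(x) = ∑ ((−1)^m / (m! Γ(m+ν+1))) (x/2)^{2m+ν}` (with `1/Γ = 0` at nonpositive
integers, which agrees with Lean's `1/0 = 0` since `Real.Gamma` vanishes there). -/
noncomputable def besselJ (ν : ℝ) (x : ℝ) : ℝ :=
  ∑' m : ℕ, ((-1 : ℝ) ^ m / (m.factorial * Real.Gamma ((m : ℝ) + ν + 1))) *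
    (x / 2) ^ (2 * (m : ℝ) + ν)

/-- Bessel function of the second kind, characterized as the limit
`(J_μ(x) cos(μπ) − J_{−μ}(x)) / sin(μπ) → Y_ν(x)` as `μ → ν` through non-integer reals. -/
noncomputable def besselY (ν : ℝ) (x : ℝ) : ℝ :=
  limUnder (𝓝[{μ : ℝ | ∀ n : ℤ, μ ≠ (n : ℝ)}] ν)
    (fun μ : ℝ => (besselJ μ x * Real.cos (μ * π) - besselJ (-μ) x) / Real.sin (μ * π))

/-- The cylinder function `C_ν(x) = cos δ · J_ν(x) − sin δ · Y_ν(x)`. -/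
noncomputable def cylinder (δ ν : ℝ) (x : ℝ) : ℝ :=
  Real.cos δ * besselJ ν x - Real.sin δ * besselY ν x

/-- One direction of the interlacing property: between any two consecutive zeros of `f`
in `I` there is exactly one zero of `g`. -/
def InterlaceHalf (f g : ℝ → ℝ) (I : Set ℝ) : Prop :=
  ∀ x₁ ∈ I, ∀ x₂ ∈ I, x₁ < x₂ → f x₁ = 0 → f x₂ = 0 →
    (∀ x ∈ Set.Ioo x₁ x₂, f x ≠ 0) →
    ∃! x, x ∈ Set.Ioo x₁ x₂ ∧ g x = 0

/-- `f` and `g` have interlaced zeros on `I`. -/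
def InterlacedOn (f g : ℝ → ℝ) (I : Set ℝ) : Prop :=
  InterlaceHalf f g I ∧ InterlaceHalf g f I

/-- `u` solves `u'' = -(1 - c/x^2) u` on `(0,∞)` with derivative `v` and amplitude `a` at `∞`. -/
structure Sol (c : ℝ) (a : ℂ) (u v : ℝ → ℝ) : Prop where
  du : ∀ x, 0 < x → HasDerivAt u (v x) x
  dv : ∀ x, 0 < x → HasDerivAt v (-(1 - c / x ^ 2) * u x) x
  lim : Tendsto (fun x : ℝ => ((v x : ℂ) + (u x : ℂ) * Complex.I) *
    Complex.exp (-((x : ℂ) * Complex.I))) atTop (𝓝 a)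

lemma Sol.lincomb {c : ℝ} {a b : ℂ} {u v u' v' : ℝ → ℝ} (h : Sol c a u v) (h' : Sol c b u' v')
    (s t : ℝ) : Sol c (s * a + t * b) (fun x => s * u x + t * u' x) (fun x => s * v x + t * v' x) where
  du x hx := ((h.du x hx).const_mul s).add ((h'.du x hx).const_mul t)
  dv x hx := by
    refine (((h.dv x hx).const_mul s).add ((h'.dv x hx).const_mul t)).congr_deriv ?_
    ring
  lim := by
    refine ((h.lim.const_mul (s : ℂ)).add (h'.lim.const_mul (t : ℂ))).congr fun x => ?_
    push_cast
    ring

lemma norm_amp (p q x : ℝ) : ‖((p : ℂ) + (q : ℂ) * Complex.I) *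
    Complex.exp (-((x : ℂ) * Complex.I))‖ ^ 2 = q ^ 2 + p ^ 2 := by
  rw [norm_mul, ← neg_mul, ← Complex.ofReal_neg, Complex.norm_exp_ofReal_mul_I, mul_one,
    ← Complex.normSq_eq_norm_sq, Complex.normSq_add_mul_I]
  ring

lemma Sol.tendsto_energy {c : ℝ} {a : ℂ} {u v : ℝ → ℝ} (h : Sol c a u v) :
    Tendsto (fun x => u x ^ 2 + v x ^ 2) atTop (𝓝 (‖a‖ ^ 2)) := by
  refine (h.lim.norm.pow 2).congr fun x => ?_
  exact norm_amp _ _ _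

lemma Sol.energy_deriv {c : ℝ} {a : ℂ} {u v : ℝ → ℝ} (h : Sol c a u v) (k x : ℝ) (hx : 0 < x) :
    HasDerivAt (fun x => (u x ^ 2 + v x ^ 2) * Real.exp (k / x))
      ((2 * c * u x * v x - k * (u x ^ 2 + v x ^ 2)) / x ^ 2 * Real.exp (k / x)) x := by
  have h1 := ((h.du x hx).pow 2).add ((h.dv x hx).pow 2)
  have h2 : HasDerivAt (fun x : ℝ => Real.exp (k / x)) (Real.exp (k / x) * (-k / x ^ 2)) x := by
    have := ((hasDerivAt_inv hx.ne').const_mul k).exp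
    refine this.congr_deriv ?_
    rw [← div_eq_mul_inv]
    ring
  refine (h1.mul h2).congr_deriv ?_
  simp only [Pi.add_apply, Pi.pow_apply]
  field_simp
  push_cast
  ring

lemma Sol.energy_le {c : ℝ} {a : ℂ} {u v : ℝ → ℝ} (h : Sol c a u v) (x : ℝ) (hx : 0 < x) :
    u x ^ 2 + v x ^ 2 ≤ ‖a‖ ^ 2 * Real.exp (|c| / x) := by
  have hm : MonotoneOn (fun x => (u x ^ 2 + v x ^ 2) * Real.exp (-|c| / x)) (Ioi 0) := by
    apply monotoneOn_of_deriv_nonneg (convex_Ioi 0)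
    · exact fun y hy => (h.energy_deriv _ y hy).continuousAt.continuousWithinAt
    · rw [interior_Ioi]
      exact fun y hy => (h.energy_deriv _ y hy).differentiableAt.differentiableWithinAt
    · rw [interior_Ioi]
      intro y hy
      rw [(h.energy_deriv _ y hy).deriv]
      have h1 : |2 * c * u y * v y| ≤ |c| * (u y ^ 2 + v y ^ 2) := by
        have : |2 * c * u y * v y| = |c| * |2 * u y * v y| := by rw [← abs_mul]; ring_nf
        rw [this]
        gcongr
        rw [abs_le]; constructor <;> nlinarith [sq_nonneg (u y - v y), sq_nonneg (u y + v y)]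
      have := (abs_le.1 h1).1
      apply mul_nonneg (div_nonneg (by linarith) (by positivity)) (Real.exp_pos _).le
  have hl : Tendsto (fun x => (u x ^ 2 + v x ^ 2) * Real.exp (-|c| / x)) atTop (𝓝 (‖a‖ ^ 2)) := by
    have h0 : Tendsto (fun x : ℝ => Real.exp (-|c| / x)) atTop (𝓝 1) := by
      rw [← Real.exp_zero]
      exact (Real.continuous_exp.tendsto 0).comp (tendsto_const_nhds.div_atTop tendsto_id)
    simpa using h.tendsto_energy.mul h0
  have := ge_of_tendsto hl (b := (u x ^ 2 + v x ^ 2) * Real.exp (-|c| / x))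
    (by filter_upwards [eventually_ge_atTop x] with y hy
        exact hm hx (lt_of_lt_of_le hx hy) hy)
  rw [neg_div, Real.exp_neg] at this
  have he := Real.exp_pos (|c| / x)
  rwa [← div_eq_mul_inv, div_le_iff₀ he] at this

lemma Sol.energy_ge {c : ℝ} {a : ℂ} {u v : ℝ → ℝ} (h : Sol c a u v) (x : ℝ) (hx : 0 < x) :
    ‖a‖ ^ 2 ≤ (u x ^ 2 + v x ^ 2) * Real.exp (|c| / x) := by
  have hm : AntitoneOn (fun x => (u x ^ 2 + v x ^ 2) * Real.exp (|c| / x)) (Ioi 0) := by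
    apply antitoneOn_of_deriv_nonpos (convex_Ioi 0)
    · exact fun y hy => (h.energy_deriv _ y hy).continuousAt.continuousWithinAt
    · rw [interior_Ioi]
      exact fun y hy => (h.energy_deriv _ y hy).differentiableAt.differentiableWithinAt
    · rw [interior_Ioi]
      intro y hy
      rw [(h.energy_deriv _ y hy).deriv]
      have h1 : |2 * c * u y * v y| ≤ |c| * (u y ^ 2 + v y ^ 2) := by
        have : |2 * c * u y * v y| = |c| * |2 * u y * v y| := by rw [← abs_mul]; ring_nf
        rw [this]
        gcongr
        rw [abs_le]; constructor <;> nlinarith [sq_nonneg (u y - v y), sq_nonneg (u y + v y)]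
      have := (abs_le.1 h1).2
      apply mul_nonpos_of_nonpos_of_nonneg
        (div_nonpos_of_nonpos_of_nonneg (by linarith) (by positivity)) (Real.exp_pos _).le
  have hl : Tendsto (fun x => (u x ^ 2 + v x ^ 2) * Real.exp (|c| / x)) atTop (𝓝 (‖a‖ ^ 2)) := by
    have h0 : Tendsto (fun x : ℝ => Real.exp (|c| / x)) atTop (𝓝 1) := by
      rw [← Real.exp_zero]
      exact (Real.continuous_exp.tendsto 0).comp (tendsto_const_nhds.div_atTop tendsto_id)
    simpa using h.tendsto_energy.mul h0
  exact le_of_tendsto hl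
    (by filter_upwards [eventually_ge_atTop x] with y hy
        exact hm hx (lt_of_lt_of_le hx hy) hy)

lemma Sol.energy_pos {c : ℝ} {a : ℂ} {u v : ℝ → ℝ} (h : Sol c a u v) (ha : a ≠ 0) (x : ℝ)
    (hx : 0 < x) : 0 < u x ^ 2 + v x ^ 2 := by
  have h1 := h.energy_ge x hx
  have h2 : 0 < ‖a‖ ^ 2 := by positivity
  have h3 := Real.exp_pos (|c| / x)
  by_contra hn
  have : (u x ^ 2 + v x ^ 2) * Real.exp (|c| / x) ≤ 0 :=
    mul_nonpos_of_nonpos_of_nonneg (not_lt.1 hn) h3.le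
  linarith

lemma wronskian_const {c : ℝ} {a b : ℂ} {u v u' v' : ℝ → ℝ} (h : Sol c a u v) (h' : Sol c b u' v')
    (x : ℝ) (hx : 0 < x) :
    v x * u' x - u x * v' x = ((starRingEnd ℂ) a * b).im := by
  have hd : ∀ y ∈ Ioi (0 : ℝ), HasDerivAt (fun x => v x * u' x - u x * v' x) 0 y := by
    intro y hy
    refine (((h.dv y hy).mul (h'.du y hy)).sub ((h.du y hy).mul (h'.dv y hy))).congr_deriv ?_
    ring
  have hc : ∀ y, 0 < y → v y * u' y - u y * v' y = v x * u' x - u x * v' x := by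
    intro y hy
    refine (convex_Ioi (0 : ℝ)).is_const_of_fderivWithin_eq_zero (𝕜 := ℝ)
      (f := fun x => v x * u' x - u x * v' x) ?_ ?_ hy hx
    · exact fun z hz => (hd z hz).differentiableAt.differentiableWithinAt
    · intro z hz
      rw [fderivWithin_of_isOpen isOpen_Ioi hz]
      have := (hd z hz).hasFDerivAt.fderiv
      rw [this]; ext; simp
  have hl : Tendsto (fun x => v x * u' x - u x * v' x) atTop (𝓝 ((starRingEnd ℂ) a * b).im) := by
    have h1 := (Complex.continuous_im.tendsto _).comp
      (((Complex.continuous_conj.tendsto _).comp h.lim).mul h'.lim)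
    refine h1.congr fun y => ?_
    simp only [Function.comp, map_mul, ← Complex.exp_conj, map_neg, Complex.conj_I, map_add,
      Complex.conj_ofReal]
    have : Complex.exp (-(↑y * -Complex.I)) * Complex.exp (-(↑y * Complex.I)) = 1 := by
      rw [← Complex.exp_add]; simp
    rw [mul_mul_mul_comm, this]
    simp
    ring
  refine tendsto_nhds_unique (tendsto_const_nhds.congr' ?_) hl
  filter_upwards [eventually_gt_atTop 0] with y hy
  exact (hc y hy).symm

/-- `γ` is a continuous Prüfer angle for the pair `(u, v)`. -/
structure PAngle (c : ℝ) (u v γ R : ℝ → ℝ) : Prop where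
  pos : ∀ x, 0 < x → 0 < R x
  hu : ∀ x, 0 < x → u x = R x * Real.sin (γ x)
  hv : ∀ x, 0 < x → v x = R x * Real.cos (γ x)
  dγ : ∀ x, 0 < x →
    HasDerivAt γ (Real.cos (γ x) ^ 2 + (1 - c / x ^ 2) * Real.sin (γ x) ^ 2) x

lemma primitive_exists {g : ℝ → ℝ} (hg : ContinuousOn g (Ioi 0)) :
    ∃ G : ℝ → ℝ, G 1 = 0 ∧ ∀ x, 0 < x → HasDerivAt G (g x) x := by
  refine ⟨fun x => ∫ t in (1 : ℝ)..x, g t, by simp, fun x hx => ?_⟩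
  apply intervalIntegral.integral_hasDerivAt_right
  · apply ContinuousOn.intervalIntegrable
    apply hg.mono
    intro t ht
    exact lt_of_lt_of_le (lt_min one_pos hx) ht.1
  · exact hg.stronglyMeasurableAtFilter isOpen_Ioi x hx
  · exact hg.continuousAt (isOpen_Ioi.mem_nhds hx)

lemma const_of_deriv_zero {f : ℝ → ℝ} (hd : ∀ x, 0 < x → HasDerivAt f 0 x) (x y : ℝ) (hx : 0 < x)
    (hy : 0 < y) : f x = f y := by
  refine (convex_Ioi (0 : ℝ)).is_const_of_fderivWithin_eq_zero (𝕜 := ℝ) (f := f) ?_ ?_ hx hy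
  · exact fun z hz => (hd z hz).differentiableAt.differentiableWithinAt
  · intro z hz
    rw [fderivWithin_of_isOpen isOpen_Ioi hz]
    have := (hd z hz).hasFDerivAt.fderiv
    rw [this]; ext; simp

lemma stay_gt {S : Set ℝ} (hS : IsPreconnected S) {h : ℝ → ℝ} (hc : ContinuousOn h S) {p : ℝ}
    (hp : ∀ x ∈ S, h x ≠ p) {y : ℝ} (hy : y ∈ S) (hyp : p < h y) : ∀ x ∈ S, p < h x := by
  intro x hx
  by_contra hn
  obtain ⟨z, hz, hz'⟩ := hS.intermediate_value hx hy hc ⟨not_lt.1 hn, hyp.le⟩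
  exact hp z hz hz'

lemma stay_lt {S : Set ℝ} (hS : IsPreconnected S) {h : ℝ → ℝ} (hc : ContinuousOn h S) {p : ℝ}
    (hp : ∀ x ∈ S, h x ≠ p) {y : ℝ} (hy : y ∈ S) (hyp : h y < p) : ∀ x ∈ S, h x < p := by
  intro x hx
  by_contra hn
  obtain ⟨z, hz, hz'⟩ := hS.intermediate_value hy hx hc ⟨hyp.le, not_lt.1 hn⟩
  exact hp z hz hz'

lemma Sol.exists_angle {c : ℝ} {a : ℂ} {u v : ℝ → ℝ} (h : Sol c a u v) (ha : a ≠ 0) :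
    ∃ γ R : ℝ → ℝ, PAngle c u v γ R := by
  have hE := h.energy_pos ha
  have cu : ContinuousOn u (Ioi 0) := fun x hx => (h.du x hx).continuousAt.continuousWithinAt
  have cv : ContinuousOn v (Ioi 0) := fun x hx => (h.dv x hx).continuousAt.continuousWithinAt
  have hg : ContinuousOn (fun x => (v x ^ 2 + (1 - c / x ^ 2) * u x ^ 2) / (u x ^ 2 + v x ^ 2))
      (Ioi 0) := by
    apply ContinuousOn.div
    · apply (cv.pow 2).add
      apply ContinuousOn.mul _ (cu.pow 2)
      apply continuousOn_const.sub
      apply continuousOn_const.div (continuousOn_id.pow 2)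
      intro x hx
      exact pow_ne_zero 2 (ne_of_gt hx)
    · exact (cu.pow 2).add (cv.pow 2)
    · exact fun x hx => (hE x hx).ne'
  obtain ⟨G, hG1, hG⟩ := primitive_exists hg
  set θ := Complex.arg ((v 1 : ℂ) + (u 1 : ℂ) * Complex.I) with hθ
  set γ : ℝ → ℝ := fun x => θ + G x with hγ
  have dγ : ∀ x, 0 < x → HasDerivAt γ
      ((v x ^ 2 + (1 - c / x ^ 2) * u x ^ 2) / (u x ^ 2 + v x ^ 2)) x :=
    fun x hx => (hG x hx).const_add θ
  set w := (v 1 : ℂ) + (u 1 : ℂ) * Complex.I with hw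
  have hw0 : 0 < ‖w‖ := by
    rw [norm_pos_iff]
    intro h0
    have h1 := congrArg Complex.re h0
    have h2 := congrArg Complex.im h0
    simp [hw] at h1 h2
    have := hE 1 one_pos
    rw [h1, h2] at this
    simp at this
  have hre : ‖w‖ * Real.cos θ = v 1 := by
    have := Complex.norm_mul_cos_arg w
    rw [this]; simp [hw]
  have him : ‖w‖ * Real.sin θ = u 1 := by
    have := Complex.norm_mul_sin_arg w
    rw [this]; simp [hw]
  have hγ1 : γ 1 = θ := by simp [hγ, hG1]
  -- the quantity Q
  have hQ : ∀ x, 0 < x → u x * Real.cos (γ x) - v x * Real.sin (γ x) = 0 := by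
    intro x hx
    have key : ∀ y, 0 < y → HasDerivAt
        (fun x => (u x * Real.cos (γ x) - v x * Real.sin (γ x)) ^ 2 / (u x ^ 2 + v x ^ 2)) 0 y := by
      intro y hy
      have hE' := hE y hy
      have h1 := ((((h.du y hy).mul (dγ y hy).cos).sub ((h.dv y hy).mul (dγ y hy).sin)).pow 2).div
        (((h.du y hy).pow 2).add ((h.dv y hy).pow 2)) hE'.ne'
      refine h1.congr_deriv ?_
      simp only [Pi.add_apply, Pi.pow_apply, Pi.mul_apply, Pi.sub_apply]
      rw [div_eq_zero_iff]
      left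
      generalize Real.cos (γ y) = C
      generalize Real.sin (γ y) = S
      push_cast
      field_simp
      ring
    have h2 := const_of_deriv_zero key x 1 hx one_pos
    simp only [hγ1] at h2
    rw [← hre, ← him] at h2
    have h3 : (‖w‖ * Real.sin θ * Real.cos θ - ‖w‖ * Real.cos θ * Real.sin θ) = 0 := by ring
    rw [h3] at h2
    have hE' := hE x hx
    simp only [ne_eq, OfNat.ofNat_ne_zero, not_false_eq_true, zero_pow, zero_div] at h2
    rw [div_eq_zero_iff] at h2
    rcases h2 with h2 | h2
    · exact pow_eq_zero_iff (two_ne_zero) |>.1 h2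
    · exact absurd h2 hE'.ne'
  have cγ : ContinuousOn γ (Ioi 0) := fun x hx => (dγ x hx).continuousAt.continuousWithinAt
  have hPE : ∀ x, 0 < x → (v x * Real.cos (γ x) + u x * Real.sin (γ x)) ^ 2 = u x ^ 2 + v x ^ 2 := by
    intro x hx
    have h1 := hQ x hx
    have h2 := Real.sin_sq_add_cos_sq (γ x)
    have : (v x * Real.cos (γ x) + u x * Real.sin (γ x)) ^ 2 +
      (u x * Real.cos (γ x) - v x * Real.sin (γ x)) ^ 2 = (u x ^ 2 + v x ^ 2) *
      (Real.sin (γ x) ^ 2 + Real.cos (γ x) ^ 2) := by ring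
    rw [h1, h2] at this
    linarith
  have hP : ∀ x ∈ Ioi (0 : ℝ), 0 < v x * Real.cos (γ x) + u x * Real.sin (γ x) := by
    refine stay_gt isPreconnected_Ioi ?_ ?_ (y := 1) (mem_Ioi.2 one_pos) ?_
    · exact (cv.mul (Real.continuous_cos.comp_continuousOn cγ)).add
        (cu.mul (Real.continuous_sin.comp_continuousOn cγ))
    · intro x hx h0
      have := hPE x hx
      rw [h0] at this
      have := hE x hx
      simp at *
      linarith
    · rw [hγ1, ← hre, ← him]
      have : ‖w‖ * Real.cos θ * Real.cos θ + ‖w‖ * Real.sin θ * Real.sin θ =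
        ‖w‖ * (Real.sin θ ^ 2 + Real.cos θ ^ 2) := by ring
      rw [this, Real.sin_sq_add_cos_sq]
      linarith
  have hu : ∀ x, 0 < x → u x = (v x * Real.cos (γ x) + u x * Real.sin (γ x)) * Real.sin (γ x) := by
    intro x hx
    linear_combination (Real.cos (γ x)) * hQ x hx - u x * Real.sin_sq_add_cos_sq (γ x)
  have hv : ∀ x, 0 < x → v x = (v x * Real.cos (γ x) + u x * Real.sin (γ x)) * Real.cos (γ x) := by
    intro x hx
    linear_combination (-Real.sin (γ x)) * hQ x hx - v x * Real.sin_sq_add_cos_sq (γ x)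
  refine ⟨γ, fun x => v x * Real.cos (γ x) + u x * Real.sin (γ x), hP, hu, hv, ?_⟩
  intro x hx
  refine (dγ x hx).congr_deriv ?_
  have h1 := hu x hx
  have h2 := hv x hx
  have hp := hP x hx
  have hp2 := hPE x hx
  set P := v x * Real.cos (γ x) + u x * Real.sin (γ x)
  rw [← hp2, h1, h2]
  have := hp.ne'
  field_simp

lemma PAngle.cont {c : ℝ} {u v γ R : ℝ → ℝ} (h : PAngle c u v γ R) : ContinuousOn γ (Ioi 0) :=
  fun x hx => (h.dγ x hx).continuousAt.continuousWithinAt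

lemma PAngle.shift {c : ℝ} {u v γ R : ℝ → ℝ} (h : PAngle c u v γ R) (k : ℤ) :
    PAngle c u v (fun x => γ x - k * (2 * π)) R where
  pos := h.pos
  hu x hx := by rw [Real.sin_sub_int_mul_two_pi]; exact h.hu x hx
  hv x hx := by rw [Real.cos_sub_int_mul_two_pi]; exact h.hv x hx
  dγ x hx := by
    rw [Real.sin_sub_int_mul_two_pi, Real.cos_sub_int_mul_two_pi]
    exact (h.dγ x hx).sub_const _

lemma PAngle.near_zero {c : ℝ} {u v γ R : ℝ → ℝ} (h : PAngle c u v γ R) {x₀ : ℝ} (hx₀ : 0 < x₀)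
    (hpos : ∀ x, 0 < x → x < x₀ → 0 < u x) :
    ∃ k : ℤ, ∀ x, 0 < x → x < x₀ → 0 < γ x - k * (2 * π) ∧ γ x - k * (2 * π) < π := by
  have hpi := Real.pi_pos
  obtain ⟨k, hk⟩ : ∃ k : ℤ, k = ⌊γ (x₀ / 2) / (2 * π)⌋ := ⟨_, rfl⟩
  have h' := h.shift k
  set g := fun x => γ x - k * (2 * π) with hg
  have hs : ∀ x ∈ Ioo 0 x₀, 0 < Real.sin (g x) := by
    intro x hx
    have h1 := hpos x hx.1 hx.2
    rw [h'.hu x hx.1] at h1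
    exact pos_of_mul_pos_right h1 (h'.pos x hx.1).le
  have hm : x₀ / 2 ∈ Ioo 0 x₀ := ⟨by linarith, by linarith⟩
  have h0 : 0 ≤ g (x₀ / 2) := by
    have := Int.floor_le (γ (x₀ / 2) / (2 * π))
    rw [le_div_iff₀ (by positivity)] at this
    simp only [hg, hk]; linarith
  have h1 : g (x₀ / 2) < 2 * π := by
    have := Int.lt_floor_add_one (γ (x₀ / 2) / (2 * π))
    rw [div_lt_iff₀ (by positivity)] at this
    simp only [hg, hk]; linarith
  have hsm := hs _ hm
  have h2 : g (x₀ / 2) < π := by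
    by_contra hn
    have := Real.sin_nonpos_of_nonpos_of_neg_pi_le (x := g (x₀ / 2) - 2 * π) (by linarith)
      (by linarith [not_lt.1 hn])
    rw [Real.sin_sub_two_pi] at this
    linarith
  have h3 : 0 < g (x₀ / 2) := lt_of_le_of_ne h0 (fun h => by rw [← h] at hsm; simp at hsm)
  have hc : ContinuousOn g (Ioo 0 x₀) := h'.cont.mono (fun x hx => hx.1)
  have A := stay_gt isPreconnected_Ioo hc (p := 0) (fun x hx h => by
    have := hs x hx; rw [h] at this; simp at this) hm h3
  have B := stay_lt isPreconnected_Ioo hc (p := π) (fun x hx h => by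
    have := hs x hx; rw [h] at this; simp at this) hm h2
  exact ⟨k, fun x hx hx' => ⟨A x ⟨hx, hx'⟩, B x ⟨hx, hx'⟩⟩⟩

lemma tendsto_branch {h : ℝ → ℝ} (hc : ContinuousOn h (Ioi 0))
    (h1 : Tendsto (fun x => Real.cos (h x)) atTop (𝓝 1))
    (h2 : Tendsto (fun x => Real.sin (h x)) atTop (𝓝 0)) :
    ∃ k : ℤ, Tendsto h atTop (𝓝 (k * (2 * π))) := by
  have hpi := Real.pi_pos
  obtain ⟨X, hX⟩ := eventually_atTop.1 ((h1.eventually (lt_mem_nhds (show (0 : ℝ) < 1 by norm_num))).and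
    (eventually_gt_atTop 0))
  obtain ⟨k, hk⟩ : ∃ k : ℤ, k = round (h X / (2 * π)) := ⟨_, rfl⟩
  have hr : |h X - k * (2 * π)| ≤ π := by
    have := abs_sub_round (h X / (2 * π))
    rw [← hk] at this
    have e : h X - k * (2 * π) = (h X / (2 * π) - k) * (2 * π) := by field_simp
    rw [e, abs_mul, abs_of_pos (show 0 < 2 * π by positivity)]
    nlinarith
  have hcos : ∀ x ∈ Ici X, 0 < Real.cos (h x - k * (2 * π)) := by
    intro x hx
    rw [Real.cos_sub_int_mul_two_pi]
    exact (hX x hx).1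
  have hcX := hcos X self_mem_Ici
  have hc' : ContinuousOn (fun x => h x - k * (2 * π)) (Ici X) :=
    (hc.mono (fun x hx => (hX x hx).2)).sub continuousOn_const
  have a1 : h X - k * (2 * π) < π / 2 := by
    by_contra hn
    have := Real.cos_nonpos_of_pi_div_two_le_of_le (not_lt.1 hn) (by linarith [(abs_le.1 hr).2])
    linarith
  have a2 : -(π / 2) < h X - k * (2 * π) := by
    by_contra hn
    have := Real.cos_nonpos_of_pi_div_two_le_of_le (x := -(h X - k * (2 * π)))
      (by linarith [not_lt.1 hn]) (by linarith [(abs_le.1 hr).1])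
    rw [Real.cos_neg] at this
    linarith
  have A := stay_gt isPreconnected_Ici hc' (p := -(π / 2)) (fun x hx h => by
    have := hcos x hx; rw [h] at this; simp at this) self_mem_Ici a2
  have B := stay_lt isPreconnected_Ici hc' (p := π / 2) (fun x hx h => by
    have := hcos x hx; rw [h] at this; simp at this) self_mem_Ici a1
  refine ⟨k, ?_⟩
  have h3 : Tendsto (fun x => Real.arcsin (Real.sin (h x)) + k * (2 * π)) atTop
      (𝓝 (Real.arcsin 0 + k * (2 * π))) :=
    ((Real.continuous_arcsin.tendsto 0).comp h2).add tendsto_const_nhds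
  rw [Real.arcsin_zero, zero_add] at h3
  refine h3.congr' ?_
  filter_upwards [eventually_ge_atTop X] with x hx
  rw [← Real.sin_sub_int_mul_two_pi (h x) k, Real.arcsin_sin (A x hx).le (B x hx).le]
  ring

lemma PAngle.tendsto {c : ℝ} {u v γ R : ℝ → ℝ} (h : PAngle c u v γ R) {A φ : ℝ} (hA : 0 < A)
    (hs : Sol c (A * Complex.exp (φ * Complex.I)) u v) :
    ∃ k : ℤ, Tendsto (fun x => γ x - x) atTop (𝓝 (φ + k * (2 * π))) := by
  have hR : Tendsto R atTop (𝓝 A) := by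
    have h1 := hs.tendsto_energy
    rw [norm_mul, Complex.norm_exp_ofReal_mul_I, mul_one, Complex.norm_real] at h1
    have h2 := (Real.continuous_sqrt.tendsto _).comp h1
    rw [Real.norm_of_nonneg hA.le, Real.sqrt_sq hA.le] at h2
    refine h2.congr' ?_
    filter_upwards [eventually_gt_atTop 0] with x hx
    have : u x ^ 2 + v x ^ 2 = R x ^ 2 := by
      rw [h.hu x hx, h.hv x hx]
      linear_combination (R x ^ 2) * Real.sin_sq_add_cos_sq (γ x)
    simp only [Function.comp, this]
    exact Real.sqrt_sq (h.pos x hx).le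
  have hz : Tendsto (fun x => Complex.exp (((γ x - x - φ : ℝ) : ℂ) * Complex.I)) atTop (𝓝 1) := by
    have h1 := (hs.lim.mul_const (Complex.exp (-(φ * Complex.I)))).div
      ((Complex.continuous_ofReal.tendsto _).comp hR) (by exact_mod_cast hA.ne')
    have h2 : (A * Complex.exp (φ * Complex.I)) * Complex.exp (-(φ * Complex.I)) / (A : ℂ) = 1 := by
      rw [mul_assoc, ← Complex.exp_add, add_neg_cancel, Complex.exp_zero, mul_one]
      exact div_self (by exact_mod_cast hA.ne')
    rw [h2] at h1
    refine h1.congr' ?_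
    filter_upwards [eventually_gt_atTop 0] with x hx
    have hR0 : (R x : ℂ) ≠ 0 := by exact_mod_cast (h.pos x hx).ne'
    have : ((v x : ℂ) + (u x : ℂ) * Complex.I) = R x * Complex.exp (γ x * Complex.I) := by
      rw [h.hu x hx, h.hv x hx, Complex.exp_mul_I]
      push_cast
      ring
    simp only [Function.comp, Pi.div_apply]
    rw [this, div_eq_iff hR0, mul_assoc, mul_assoc, ← Complex.exp_add, ← Complex.exp_add, mul_comm]
    push_cast
    ring_nf
  have h1 := (Complex.continuous_re.tendsto _).comp hz
  have h2 := (Complex.continuous_im.tendsto _).comp hz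
  simp only [Function.comp_def, Complex.exp_ofReal_mul_I_re, Complex.exp_ofReal_mul_I_im,
    Complex.one_re, Complex.one_im] at h1 h2
  obtain ⟨k, hk⟩ := tendsto_branch ((h.cont.sub continuousOn_id).sub continuousOn_const) h1 h2
  refine ⟨k, ?_⟩
  have := hk.add_const φ
  rw [add_comm] at this
  refine this.congr fun x => ?_
  simp

lemma integrating {Δ a b : ℝ → ℝ} (ha : ContinuousOn a (Ioi 0))
    (hd : ∀ x, 0 < x → HasDerivAt Δ (a x * Δ x + b x) x) :
    ∃ e : ℝ → ℝ, (∀ x, 0 < e x) ∧ ∀ x, 0 < x → HasDerivAt (fun x => Δ x * e x) (b x * e x) x := by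
  obtain ⟨G, -, hG⟩ := primitive_exists ha
  refine ⟨fun x => Real.exp (-G x), fun x => Real.exp_pos _, fun x hx => ?_⟩
  refine ((hd x hx).mul (hG x hx).neg.exp).congr_deriv ?_
  simp only [Pi.neg_apply]
  ring

lemma gronwall_pos {Δ a b : ℝ → ℝ} (ha : ContinuousOn a (Ioi 0))
    (hd : ∀ x, 0 < x → HasDerivAt Δ (a x * Δ x + b x) x) (hb : ∀ x, 0 < x → 0 ≤ b x)
    {x y : ℝ} (hx : 0 < x) (hxy : x ≤ y) (h : 0 < Δ x) : 0 < Δ y := by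
  obtain ⟨e, he, hD⟩ := integrating ha hd
  have hm : MonotoneOn (fun x => Δ x * e x) (Ioi 0) := by
    apply monotoneOn_of_deriv_nonneg (convex_Ioi 0)
    · exact fun y hy => (hD y hy).continuousAt.continuousWithinAt
    · rw [interior_Ioi]
      exact fun y hy => (hD y hy).differentiableAt.differentiableWithinAt
    · rw [interior_Ioi]
      intro y hy
      rw [(hD y hy).deriv]
      exact mul_nonneg (hb y hy) (he y).le
  have := hm hx (lt_of_lt_of_le hx hxy) hxy
  have h2 : 0 < Δ x * e x := mul_pos h (he x)
  exact pos_of_mul_pos_left (lt_of_lt_of_le h2 this) (he y).le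

lemma gronwall_strict {Δ a b : ℝ → ℝ} (ha : ContinuousOn a (Ioi 0))
    (hd : ∀ x, 0 < x → HasDerivAt Δ (a x * Δ x + b x) x) (hb : ∀ x, 0 < x → 0 < b x)
    {x y : ℝ} (hx : 0 < x) (hxy : x < y) (h : 0 ≤ Δ x) : 0 < Δ y := by
  obtain ⟨e, he, hD⟩ := integrating ha hd
  have hm : StrictMonoOn (fun x => Δ x * e x) (Ioi 0) := by
    apply strictMonoOn_of_deriv_pos (convex_Ioi 0)
    · exact fun y hy => (hD y hy).continuousAt.continuousWithinAt
    · rw [interior_Ioi]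
      intro y hy
      rw [(hD y hy).deriv]
      exact mul_pos (hb y hy) (he y)
  have := hm hx (lt_trans hx hxy) hxy
  have h2 : 0 ≤ Δ x * e x := mul_nonneg h (he x).le
  exact pos_of_mul_pos_left (lt_of_le_of_lt h2 this) (he y).le

lemma sinc_mul (t : ℝ) : Real.sinc t * t = Real.sin t := by
  by_cases h : t = 0
  · simp [h]
  · rw [Real.sinc_of_ne_zero h]; field_simp

lemma PAngle.cross {c : ℝ} {u v γ R : ℝ → ℝ} (h : PAngle c u v γ R) (m : ℤ) {x y : ℝ} (hx : 0 < x)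
    (hxy : x < y) (hm : m * π ≤ γ x) : m * π < γ y := by
  have key : 0 < γ y - m * π := by
    refine gronwall_strict (Δ := fun x => γ x - m * π) (b := fun _ => 1)
      (a := fun x => -(c / x ^ 2) * (Real.sinc (γ x - m * π) * Real.sin (γ x - m * π)))
      ?_ ?_ (fun _ _ => one_pos) hx hxy (sub_nonneg.2 hm)
    · have hc := h.cont.sub (continuousOn_const (c := (m * π : ℝ)))
      apply ContinuousOn.mul
      · apply ContinuousOn.neg
        apply continuousOn_const.div (continuousOn_id.pow 2)
        intro x hx
        exact pow_ne_zero 2 (ne_of_gt hx)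
      · exact (Real.continuous_sinc.comp_continuousOn hc).mul
          (Real.continuous_sin.comp_continuousOn hc)
    · intro z hz
      refine ((h.dγ z hz).sub_const _).congr_deriv ?_
      have h1 := sinc_mul (γ z - m * π)
      have h2 : Real.sin (γ z - m * π) ^ 2 = Real.sin (γ z) ^ 2 := by
        have e : ((-1 : ℝ) ^ m) ^ 2 = 1 := by
          rw [← zpow_natCast, ← zpow_mul, mul_comm, zpow_mul]; simp
        rw [Real.sin_sub_int_mul_pi, mul_pow, e, one_mul]
      have h3 := Real.sin_sq_add_cos_sq (γ z)
      have h4 : -(c / z ^ 2) * (Real.sinc (γ z - m * π) * Real.sin (γ z - m * π)) * (γ z - m * π) + 1 =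
        -(c / z ^ 2) * (Real.sin (γ z)) ^ 2 + 1 := by
        rw [← h2]
        linear_combination (-(c / z ^ 2) * Real.sin (γ z - m * π)) * h1
      rw [h4]
      linear_combination h3
  linarith

/-- Sturm comparison for angles. -/
lemma PAngle.compare {c c' : ℝ} {u v γ R u' v' γ' R' : ℝ → ℝ} (h : PAngle c u v γ R)
    (h' : PAngle c' u' v' γ' R') (hcc : c ≤ c') {x y : ℝ} (hx : 0 < x) (hxy : x ≤ y)
    (hlt : γ' x < γ x) : γ' y < γ y := by
  have key : 0 < γ y - γ' y := by
    refine gronwall_pos (Δ := fun x => γ x - γ' x)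
      (b := fun x => (c' - c) / x ^ 2 * Real.sin (γ' x) ^ 2)
      (a := fun x => -(c / x ^ 2) * (Real.sinc (γ x - γ' x) * Real.sin (γ x + γ' x)))
      ?_ ?_ (fun z hz => ?_) hx hxy (sub_pos.2 hlt)
    · apply ContinuousOn.mul
      · apply ContinuousOn.neg
        apply continuousOn_const.div (continuousOn_id.pow 2)
        intro x hx
        exact pow_ne_zero 2 (ne_of_gt hx)
      · exact (Real.continuous_sinc.comp_continuousOn (h.cont.sub h'.cont)).mul
          (Real.continuous_sin.comp_continuousOn (h.cont.add h'.cont))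
    · intro z hz
      refine ((h.dγ z hz).sub (h'.dγ z hz)).congr_deriv ?_
      have h1 := sinc_mul (γ z - γ' z)
      have h2 : Real.sin (γ z - γ' z) * Real.sin (γ z + γ' z) =
          Real.sin (γ z) ^ 2 - Real.sin (γ' z) ^ 2 := by
        rw [Real.sin_sub, Real.sin_add]
        linear_combination (Real.sin (γ z) ^ 2) * Real.sin_sq_add_cos_sq (γ' z) -
          (Real.sin (γ' z) ^ 2) * Real.sin_sq_add_cos_sq (γ z)
      have h3 := Real.sin_sq_add_cos_sq (γ z)
      have h4 := Real.sin_sq_add_cos_sq (γ' z)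
      have h5 : -(c / z ^ 2) * (Real.sinc (γ z - γ' z) * Real.sin (γ z + γ' z)) * (γ z - γ' z) =
          -(c / z ^ 2) * (Real.sin (γ z) ^ 2 - Real.sin (γ' z) ^ 2) := by
        rw [← h2, ← h1]; ring
      rw [h5, sub_div]
      linear_combination h3 - h4
    · exact mul_nonneg (div_nonneg (sub_nonneg.2 hcc) (sq_nonneg _)) (sq_nonneg _)
  linarith

lemma PAngle.zero_iff {c : ℝ} {u v γ R : ℝ → ℝ} (h : PAngle c u v γ R) {x : ℝ} (hx : 0 < x) :
    u x = 0 ↔ ∃ n : ℤ, n * π = γ x := by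
  rw [h.hu x hx, mul_eq_zero, or_iff_right (h.pos x hx).ne', Real.sin_eq_zero_iff]

theorem not_interlaceHalf {c c' L L' : ℝ} {u v γ R u' v' γ' R' : ℝ → ℝ} (h : PAngle c u v γ R)
    (h' : PAngle c' u' v' γ' R') {x₀ x₁ : ℝ} (hx₀ : 0 < x₀) (hx₁ : 0 < x₁)
    (h0 : ∀ x, 0 < x → x < x₀ → 0 < γ x ∧ γ x < π)
    (h0' : ∀ x, 0 < x → x < x₁ → 0 < γ' x ∧ γ' x < π)
    (hL : Tendsto (fun x => γ x - x) atTop (𝓝 L))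
    (hL' : Tendsto (fun x => γ' x - x) atTop (𝓝 L')) (hD : π < L - L') :
    ¬ InterlaceHalf u u' (Ioi 0) := by
  intro hI
  have hpi := Real.pi_pos
  have hTop : Tendsto γ atTop atTop := by
    have := hL.add_atTop tendsto_id
    refine this.congr fun x => ?_
    simp
  have hex : ∀ j : ℕ, ∃ x, 0 < x ∧ γ x = (j + 1 : ℕ) * π := by
    intro j
    obtain ⟨X, hX, hX0⟩ := ((hTop.eventually_ge_atTop ((j + 1 : ℕ) * π)).and
      (eventually_gt_atTop 0)).exists
    have hs := h0 (x₀ / 2) (by linarith) (by linarith)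
    have hm : γ (x₀ / 2) ≤ (j + 1 : ℕ) * π := by
      have : (1 : ℝ) ≤ (j + 1 : ℕ) := by push_cast; linarith [(Nat.cast_nonneg j : (0 : ℝ) ≤ j)]
      nlinarith
    obtain ⟨z, hz, hz'⟩ := isPreconnected_Ioi.intermediate_value (show x₀ / 2 ∈ Ioi 0 from half_pos hx₀)
      (show X ∈ Ioi (0 : ℝ) from hX0) h.cont ⟨hm, hX⟩
    exact ⟨z, hz, hz'⟩
  choose x hx0 hxγ using hex
  have hlt : ∀ j, x j < x (j + 1) := by
    intro j
    by_contra hn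
    rcases (not_lt.1 hn).lt_or_eq with h1 | h1
    · have := h.cross ((j + 1 + 1 : ℕ) : ℤ) (hx0 _) h1 (by rw [hxγ]; push_cast; rfl)
      rw [hxγ] at this
      push_cast at this
      nlinarith
    · have h2 := hxγ (j + 1)
      rw [h1, hxγ] at h2
      push_cast at h2
      nlinarith
  have hind : ∀ j : ℕ, (j : ℝ) * π < γ' (x j) := by
    intro j
    induction j with
    | zero =>
      set t := min (x₁ / 2) (x 0 / 2) with ht
      have ht0 : 0 < t := lt_min (half_pos hx₁) (half_pos (hx0 0))
      have ht1 : t < x₁ := lt_of_le_of_lt (min_le_left _ _) (half_lt_self hx₁)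
      have ht2 : t < x 0 := lt_of_le_of_lt (min_le_right _ _) (half_lt_self (hx0 0))
      have := h'.cross 0 ht0 ht2 (by simpa using (h0' t ht0 ht1).1.le)
      simpa using this
    | succ j ih =>
      have hz1 : u (x j) = 0 := (h.zero_iff (hx0 _)).2 ⟨(j + 1 : ℕ), by rw [hxγ]; push_cast; rfl⟩
      have hz2 : u (x (j + 1)) = 0 :=
        (h.zero_iff (hx0 _)).2 ⟨(j + 1 + 1 : ℕ), by rw [hxγ]; push_cast; rfl⟩
      obtain ⟨t, ⟨ht, htz⟩, -⟩ := hI (x j) (hx0 _) (x (j + 1)) (hx0 _) (hlt j) hz1 hz2 (by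
        intro s hs hs0
        have hs' : 0 < s := (hx0 j).trans hs.1
        obtain ⟨n, hn⟩ := (h.zero_iff hs').1 hs0
        have e1 := h.cross ((j + 1 : ℕ) : ℤ) (hx0 j) hs.1 (by rw [hxγ]; push_cast; rfl)
        have e2 := h.cross n hs' hs.2 hn.le
        rw [← hn] at e1
        rw [hxγ] at e2
        have e3 := lt_of_mul_lt_mul_right e1 hpi.le
        have e4 := lt_of_mul_lt_mul_right e2 hpi.le
        have e5 : ((j + 1 : ℕ) : ℤ) < n := by exact_mod_cast e3
        have e6 : n < ((j + 1 + 1 : ℕ) : ℤ) := by exact_mod_cast e4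
        omega)
      have ht' : 0 < t := (hx0 j).trans ht.1
      obtain ⟨n, hn⟩ := (h'.zero_iff ht').1 htz
      have e1 := h'.cross (j : ℤ) (hx0 j) ht.1 (by push_cast; exact ih.le)
      rw [← hn] at e1
      have e3 := lt_of_mul_lt_mul_right e1 hpi.le
      have e5 : (j : ℤ) < n := by exact_mod_cast e3
      have e2 := h'.cross ((j + 1 : ℕ) : ℤ) ht' ht.2 (by
        rw [← hn]
        apply mul_le_mul_of_nonneg_right _ hpi.le
        have : ((j + 1 : ℕ) : ℤ) ≤ n := by push_cast; omega
        exact_mod_cast this)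
      simpa using e2
  have hdiff : Tendsto (fun x => γ x - γ' x) atTop (𝓝 (L - L')) := by
    refine (hL.sub hL').congr fun x => ?_
    ring
  obtain ⟨X, hX⟩ := eventually_atTop.1 ((hdiff.eventually (lt_mem_nhds hD)).and
    (eventually_gt_atTop 0))
  obtain ⟨j, hj⟩ := exists_nat_gt (γ X / π)
  have hXj : X ≤ x j := by
    by_contra hn
    have := h.cross ((j + 1 : ℕ) : ℤ) (hx0 j) (not_le.1 hn) (by rw [hxγ]; push_cast; rfl)
    rw [div_lt_iff₀ hpi] at hj
    push_cast at this
    nlinarith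
  have h1 := (hX _ hXj).1
  have h2 := hind j
  rw [hxγ] at h1
  push_cast at h1
  linarith

/-- The entire function `∑ (-t)^m / (m! Γ(m+s+1))`. -/
noncomputable def phiC (s t : ℂ) : ℂ :=
  ∑' m : ℕ, (-t) ^ m / (m.factorial : ℂ) * (Complex.Gamma ((m : ℂ) + s + 1))⁻¹

noncomputable def phi (ν t : ℝ) : ℝ :=
  ∑' m : ℕ, (-t) ^ m / (m.factorial : ℝ) * (Real.Gamma ((m : ℝ) + ν + 1))⁻¹

lemma inv_Gamma_rec (z : ℂ) : (Complex.Gamma z)⁻¹ = z * (Complex.Gamma (z + 1))⁻¹ :=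
  Complex.one_div_Gamma_eq_self_mul_one_div_Gamma_add_one z

lemma inv_Gamma_bound (r : ℝ) : ∃ C : ℝ, 0 ≤ C ∧ ∀ s : ℂ, ‖s‖ ≤ r → ∀ m : ℕ,
    ‖(Complex.Gamma ((m : ℂ) + s + 1))⁻¹‖ ≤ C := by
  have h1 : ∀ m : ℕ, ∃ C : ℝ, ∀ s ∈ Metric.closedBall (0 : ℂ) r,
      ‖(Complex.Gamma ((m : ℂ) + s + 1))⁻¹‖ ≤ C := by
    intro m
    apply (isCompact_closedBall (0 : ℂ) r).exists_bound_of_continuousOn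
    have := Complex.differentiable_one_div_Gamma.continuous
    exact (this.comp (by fun_prop : Continuous fun s : ℂ => (m : ℂ) + s + 1)).continuousOn
  choose C hC using h1
  set N := ⌈r⌉₊ with hN
  refine ⟨∑ m ∈ Finset.range (N + 1), |C m|, Finset.sum_nonneg fun _ _ => abs_nonneg _, ?_⟩
  intro s hs m
  have hs' : s ∈ Metric.closedBall (0 : ℂ) r := by simpa using hs
  have small : ∀ m ≤ N, ‖(Complex.Gamma ((m : ℂ) + s + 1))⁻¹‖ ≤ ∑ m ∈ Finset.range (N + 1), |C m| := by
    intro m hm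
    refine (hC m s hs').trans ((le_abs_self _).trans ?_)
    exact Finset.single_le_sum (f := fun m => |C m|) (fun _ _ => abs_nonneg _)
      (Finset.mem_range.2 (by omega))
  rcases le_total m N with hm | hm
  · exact small m hm
  · induction m, hm using Nat.le_induction with
    | base => exact small N le_rfl
    | succ m hm ih =>
      have e := inv_Gamma_rec ((m : ℂ) + s + 1)
      have hz : 1 ≤ ‖(m : ℂ) + s + 1‖ := by
        have h1 : ‖((m : ℂ) + 1)‖ = m + 1 := by
          have : ((m : ℂ) + 1) = ((m + 1 : ℕ) : ℂ) := by push_cast; rfl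
          rw [this, Complex.norm_natCast]; push_cast; rfl
        have h2 : ‖((m : ℂ) + 1)‖ - ‖s‖ ≤ ‖(m : ℂ) + 1 + s‖ := by
          have := norm_sub_norm_le ((m : ℂ) + 1) (-s)
          simpa using this
        have h3 : r ≤ m := (Nat.le_ceil r).trans (by exact_mod_cast hm)
        have h4 : (m : ℂ) + s + 1 = (m : ℂ) + 1 + s := by ring
        rw [h4]
        linarith
      have e2 : ((m + 1 : ℕ) : ℂ) + s + 1 = (m : ℂ) + s + 1 + 1 := by push_cast; ring
      rw [e2]
      rw [e, norm_mul] at ih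
      refine le_trans ?_ ih
      exact le_mul_of_one_le_left (norm_nonneg _) hz

lemma term_bound {C : ℝ} {s t : ℂ} {ρ : ℝ} (ht : ‖t‖ ≤ ρ) (m : ℕ)
    (h : ‖(Complex.Gamma ((m : ℂ) + s + 1))⁻¹‖ ≤ C) :
    ‖(-t) ^ m / (m.factorial : ℂ) * (Complex.Gamma ((m : ℂ) + s + 1))⁻¹‖ ≤
      ρ ^ m / m.factorial * C := by
  have hρ : 0 ≤ ρ := (norm_nonneg t).trans ht
  rw [norm_mul, norm_div, norm_pow, norm_neg, Complex.norm_natCast]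
  gcongr

lemma phiC_summable (s t : ℂ) : Summable fun m : ℕ =>
    (-t) ^ m / (m.factorial : ℂ) * (Complex.Gamma ((m : ℂ) + s + 1))⁻¹ := by
  obtain ⟨C, hC0, hC⟩ := inv_Gamma_bound ‖s‖
  refine Summable.of_norm_bounded ((Real.summable_pow_div_factorial ‖t‖).mul_right C) fun m => ?_
  exact term_bound le_rfl m (hC s le_rfl m)

lemma phiC_differentiable_s (t : ℂ) : Differentiable ℂ fun s => phiC s t := by
  intro s
  obtain ⟨C, hC0, hC⟩ := inv_Gamma_bound (‖s‖ + 1)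
  have : DifferentiableOn ℂ (fun s => phiC s t) (Metric.ball 0 (‖s‖ + 1)) := by
    refine Complex.differentiableOn_tsum_of_summable_norm
      ((Real.summable_pow_div_factorial ‖t‖).mul_right C) (fun m => ?_) Metric.isOpen_ball ?_
    · apply Differentiable.differentiableOn
      apply Differentiable.const_mul
      exact Complex.differentiable_one_div_Gamma.comp
        (by fun_prop : Differentiable ℂ fun s : ℂ => (m : ℂ) + s + 1)
    · intro m w hw
      refine term_bound le_rfl m (hC w ?_ m)
      simpa using (mem_ball_zero_iff.1 hw).le
  exact this.differentiableAt (Metric.isOpen_ball.mem_nhds (by simp))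

lemma phiC_hasDerivAt (s t : ℂ) : HasDerivAt (fun t => phiC s t) (-phiC (s + 1) t) t := by
  obtain ⟨C, hC0, hC⟩ := inv_Gamma_bound ‖s‖
  have hd : ∀ m : ℕ, Differentiable ℂ fun t : ℂ =>
      (-t) ^ m / (m.factorial : ℂ) * (Complex.Gamma ((m : ℂ) + s + 1))⁻¹ := by
    intro m; fun_prop
  have hu := (Real.summable_pow_div_factorial (‖t‖ + 1)).mul_right C
  have hb : ∀ (m : ℕ) (w : ℂ), w ∈ Metric.ball (0 : ℂ) (‖t‖ + 1) →
      ‖(-w) ^ m / (m.factorial : ℂ) * (Complex.Gamma ((m : ℂ) + s + 1))⁻¹‖ ≤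
      (‖t‖ + 1) ^ m / m.factorial * C := by
    intro m w hw
    exact term_bound (mem_ball_zero_iff.1 hw).le m (hC s le_rfl m)
  have ht : t ∈ Metric.ball (0 : ℂ) (‖t‖ + 1) := by simp
  have h1 := Complex.differentiableOn_tsum_of_summable_norm hu (fun m => (hd m).differentiableOn)
    Metric.isOpen_ball hb
  have h2 := Complex.hasSum_deriv_of_summable_norm hu (fun m => (hd m).differentiableOn)
    Metric.isOpen_ball hb ht
  have h3 := (h1.differentiableAt (Metric.isOpen_ball.mem_nhds ht)).hasDerivAt
  refine h3.congr_deriv ?_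
  rw [← h2.tsum_eq, h2.summable.tsum_eq_zero_add]
  have hder : ∀ m : ℕ, deriv (fun t : ℂ => (-t) ^ (m + 1) / ((m + 1).factorial : ℂ) *
      (Complex.Gamma (((m + 1 : ℕ) : ℂ) + s + 1))⁻¹) t =
      -((-t) ^ m / (m.factorial : ℂ) * (Complex.Gamma ((m : ℂ) + (s + 1) + 1))⁻¹) := by
    intro m
    have e : ((m + 1 : ℕ) : ℂ) + s + 1 = (m : ℂ) + (s + 1) + 1 := by push_cast; ring
    rw [e]
    have h4 : HasDerivAt (fun t : ℂ => (-t) ^ (m + 1) / ((m + 1).factorial : ℂ) *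
      (Complex.Gamma ((m : ℂ) + (s + 1) + 1))⁻¹) (((m + 1 : ℕ) : ℂ) * (-t) ^ m * (-1) /
        ((m + 1).factorial : ℂ) * (Complex.Gamma ((m : ℂ) + (s + 1) + 1))⁻¹) t := by
      have := (((hasDerivAt_id t).neg.pow (m + 1)).div_const ((m + 1).factorial : ℂ)).mul_const
        ((Complex.Gamma ((m : ℂ) + (s + 1) + 1))⁻¹)
      simpa using this
    rw [h4.deriv, Nat.factorial_succ]
    have : ((m : ℂ) + 1) ≠ 0 := by exact_mod_cast Nat.succ_ne_zero m
    have h5 : ((m.factorial : ℕ) : ℂ) ≠ 0 := by exact_mod_cast Nat.factorial_ne_zero m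
    push_cast
    field_simp
  simp only [hder]
  rw [tsum_neg, phiC]
  simp

lemma phiC_rec (s t : ℂ) : phiC s t = (s + 1) * phiC (s + 1) t - t * phiC (s + 2) t := by
  have h0 := phiC_summable s t
  have h1 := (phiC_summable (s + 1) t).mul_left (s + 1)
  have h2 : Summable fun m : ℕ => (m : ℂ) * ((-t) ^ m / (m.factorial : ℂ) *
      (Complex.Gamma ((m : ℂ) + (s + 1) + 1))⁻¹) := by
    refine (h0.sub h1).congr fun m => ?_
    have e := inv_Gamma_rec ((m : ℂ) + s + 1)
    have e2 : (m : ℂ) + s + 1 + 1 = (m : ℂ) + (s + 1) + 1 := by ring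
    rw [e, e2]
    ring
  have h3 : phiC s t = (s + 1) * phiC (s + 1) t + ∑' m : ℕ, (m : ℂ) * ((-t) ^ m / (m.factorial : ℂ) *
      (Complex.Gamma ((m : ℂ) + (s + 1) + 1))⁻¹) := by
    rw [phiC, phiC, ← tsum_mul_left, ← h1.tsum_add h2]
    congr 1
    ext m
    have e := inv_Gamma_rec ((m : ℂ) + s + 1)
    have e2 : (m : ℂ) + s + 1 + 1 = (m : ℂ) + (s + 1) + 1 := by ring
    rw [e, e2]
    ring
  rw [h3, h2.tsum_eq_zero_add, phiC, phiC, ← tsum_mul_left, ← tsum_mul_left, sub_eq_add_neg,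
    ← tsum_neg]
  congr 1
  rw [Nat.cast_zero, zero_mul, zero_add]
  congr 1
  ext m
  have e : ((m + 1 : ℕ) : ℂ) + (s + 1) + 1 = (m : ℂ) + (s + 2) + 1 := by push_cast; ring
  rw [e, Nat.factorial_succ]
  have : ((m : ℂ) + 1) ≠ 0 := by exact_mod_cast Nat.succ_ne_zero m
  have h5 : ((m.factorial : ℕ) : ℂ) ≠ 0 := by exact_mod_cast Nat.factorial_ne_zero m
  push_cast
  field_simp
  ring

lemma phi_ofReal (ν t : ℝ) : ((phi ν t : ℝ) : ℂ) = phiC ν t := by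
  rw [phi, phiC, Complex.ofReal_tsum]
  congr 1
  ext m
  have : (m : ℂ) + (ν : ℂ) + 1 = (((m : ℝ) + ν + 1 : ℝ) : ℂ) := by push_cast; rfl
  rw [this, Complex.Gamma_ofReal]
  push_cast
  rfl

lemma phi_eq_re (ν t : ℝ) : phi ν t = (phiC ν t).re := by
  rw [← phi_ofReal, Complex.ofReal_re]

lemma phi_summable (ν t : ℝ) : Summable fun m : ℕ =>
    (-t) ^ m / (m.factorial : ℝ) * (Real.Gamma ((m : ℝ) + ν + 1))⁻¹ := by
  rw [← Complex.summable_ofReal]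
  refine (phiC_summable ν t).congr fun m => ?_
  have : (m : ℂ) + (ν : ℂ) + 1 = (((m : ℝ) + ν + 1 : ℝ) : ℂ) := by push_cast; rfl
  rw [this, Complex.Gamma_ofReal]
  push_cast
  rfl

lemma phi_rec (ν t : ℝ) : phi ν t = (ν + 1) * phi (ν + 1) t - t * phi (ν + 2) t := by
  have h := phiC_rec ν t
  have e1 : (ν : ℂ) + 1 = ((ν + 1 : ℝ) : ℂ) := by push_cast; rfl
  have e2 : (ν : ℂ) + 2 = ((ν + 2 : ℝ) : ℂ) := by push_cast; rfl
  rw [e1, e2, ← phi_ofReal, ← phi_ofReal, ← phi_ofReal] at h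
  exact_mod_cast h

lemma phi_hasDerivAt (ν t : ℝ) : HasDerivAt (fun t => phi ν t) (-phi (ν + 1) t) t := by
  have h := (phiC_hasDerivAt ν t).real_of_complex
  have e1 : (ν : ℂ) + 1 = ((ν + 1 : ℝ) : ℂ) := by push_cast; rfl
  rw [e1, ← phi_ofReal] at h
  simpa [← phi_eq_re] using h

lemma phi_differentiable (t : ℝ) : Differentiable ℝ fun ν => phi ν t := by
  intro ν
  have h := ((phiC_differentiable_s t).differentiableAt (x := (ν : ℂ))).hasDerivAt.real_of_complex
  simp only [← phi_eq_re] at h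
  exact h.differentiableAt

lemma phi_zero (ν : ℝ) : phi ν 0 = (Real.Gamma (ν + 1))⁻¹ := by
  rw [phi, tsum_eq_single 0]
  · simp
  · intro m hm
    simp [hm]

lemma besselJ_eq (ν x : ℝ) (hx : 0 < x) : besselJ ν x = (x / 2) ^ ν * phi ν ((x / 2) ^ 2) := by
  rw [besselJ, phi, ← tsum_mul_left]
  congr 1
  ext m
  have h : 0 < x / 2 := by positivity
  rw [Real.rpow_add h, Real.rpow_mul h.le, Real.rpow_natCast, neg_pow ((x / 2) ^ 2)]
  rw [Real.rpow_ofNat]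
  rw [div_mul_eq_mul_div, div_mul_eq_mul_div, div_eq_mul_inv, div_eq_mul_inv, mul_inv]
  ring

lemma phi_neg_nat (n : ℕ) (t : ℝ) : phi (-n) t = (-t) ^ n * phi n t := by
  have hs := phi_summable (-n) t
  rw [phi, ← hs.sum_add_tsum_nat_add n, Finset.sum_eq_zero, zero_add, phi, ← tsum_mul_left]
  · congr 1
    ext m
    have e1 : ((m + n : ℕ) : ℝ) + -(n : ℝ) + 1 = (m : ℝ) + 1 := by push_cast; ring
    have e2 : (m : ℝ) + n + 1 = ((m + n : ℕ) : ℝ) + 1 := by push_cast; ring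
    rw [e1, e2, Real.Gamma_nat_eq_factorial, Real.Gamma_nat_eq_factorial, pow_add]
    ring
  · intro m hm
    have : (m : ℝ) + -(n : ℝ) + 1 = -((n - 1 - m : ℕ) : ℝ) := by
      have := Finset.mem_range.1 hm
      rw [Nat.sub_sub, Nat.cast_sub (by omega)]
      push_cast; ring
    rw [this, Real.Gamma_neg_nat_eq_zero]
    simp

lemma besselJ_neg_nat (n : ℕ) (x : ℝ) (hx : 0 < x) :
    besselJ (-n) x = (-1) ^ n * besselJ n x := by
  have h : 0 < x / 2 := by positivity
  rw [besselJ_eq _ _ hx, besselJ_eq _ _ hx, phi_neg_nat, Real.rpow_neg h.le, Real.rpow_natCast,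
    neg_pow ((x / 2) ^ 2), ← pow_mul, mul_comm 2 n, pow_mul]
  have := (pow_pos h n).ne'
  field_simp

lemma besselJ_rec (ν x : ℝ) (hx : 0 < x) :
    besselJ ν x = 2 * (ν + 1) / x * besselJ (ν + 1) x - besselJ (ν + 2) x := by
  have h : 0 < x / 2 := by positivity
  rw [besselJ_eq _ _ hx, besselJ_eq _ _ hx, besselJ_eq _ _ hx, phi_rec, Real.rpow_add h,
    Real.rpow_add h, Real.rpow_one, Real.rpow_ofNat]
  field_simp

lemma besselJ_hasDerivAt (ν x : ℝ) (hx : 0 < x) :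
    HasDerivAt (besselJ ν) (ν / x * besselJ ν x - besselJ (ν + 1) x) x := by
  have h : 0 < x / 2 := by positivity
  have h1 : HasDerivAt (fun x : ℝ => x / 2) (1 / 2) x := (hasDerivAt_id x).div_const 2
  have h2 := h1.rpow_const (p := ν) (Or.inl h.ne')
  have h3 := (phi_hasDerivAt ν ((x / 2) ^ 2)).comp x (h1.pow 2)
  have h4 := h2.mul h3
  have h5 : HasDerivAt (besselJ ν) _ x := h4.congr_of_eventuallyEq (by
    filter_upwards [lt_mem_nhds hx] with y hy
    exact besselJ_eq ν y hy)
  refine h5.congr_deriv ?_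
  rw [besselJ_eq _ _ hx, besselJ_eq _ _ hx, Real.rpow_add h, Real.rpow_one, Real.rpow_sub h,
    Real.rpow_one]
  simp only [Function.comp, Pi.pow_apply]
  push_cast
  field_simp
  ring

lemma besselJ_differentiable_order (x : ℝ) (hx : 0 < x) : Differentiable ℝ fun ν => besselJ ν x := by
  have h : 0 < x / 2 := by positivity
  simp only [besselJ_eq _ _ hx]
  apply Differentiable.mul _ (phi_differentiable _)
  intro ν
  exact ((hasDerivAt_id ν).const_rpow h).differentiableAt

lemma beta_real {p q : ℝ} (hp : 0 < p) (hq : 0 < q) :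
    ∫ x in Ioc (0 : ℝ) 1, x ^ (p - 1) * (1 - x) ^ (q - 1) =
      Real.Gamma p * Real.Gamma q / Real.Gamma (p + q) := by
  have h1 := ProbabilityTheory.beta_eq_betaIntegralReal p q hp hq
  rw [ProbabilityTheory.beta] at h1
  rw [h1, Complex.betaIntegral]
  have h2 : ∫ x in (0 : ℝ)..1, (x : ℂ) ^ ((p : ℂ) - 1) * (1 - (x : ℂ)) ^ ((q : ℂ) - 1) =
      ∫ x in (0 : ℝ)..1, ((x ^ (p - 1) * (1 - x) ^ (q - 1) : ℝ) : ℂ) := by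
    apply intervalIntegral.integral_congr
    intro x hx
    rw [uIcc_of_le zero_le_one] at hx
    simp only
    rw [Complex.ofReal_mul, Complex.ofReal_cpow hx.1, Complex.ofReal_cpow (sub_nonneg.2 hx.2)]
    push_cast
    rfl
  rw [h2, intervalIntegral.integral_ofReal, Complex.ofReal_re,
    intervalIntegral.integral_of_le zero_le_one]

lemma moment {a : ℝ} (ha : 0 < a) (m : ℕ) :
    ∫ t in (0 : ℝ)..1, t ^ (2 * m) * (1 - t ^ 2) ^ (a - 1) =
      1 / 2 * (Real.Gamma (m + 1 / 2) * Real.Gamma a / Real.Gamma (m + 1 / 2 + a)) := by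
  have hp : (0 : ℝ) < m + 1 / 2 := by positivity
  rw [← beta_real hp ha, intervalIntegral.integral_of_le zero_le_one]
  set g : ℝ → ℝ := (Ioc (0 : ℝ) 1).indicator
    (fun x : ℝ => x ^ ((m : ℝ) + 1 / 2 - 1) * (1 - x) ^ (a - 1)) with hg
  have h1 := MeasureTheory.integral_comp_rpow_Ioi_of_pos (g := g) (zero_lt_two : (0 : ℝ) < 2)
  have hsub : Ioc (0 : ℝ) 1 ⊆ Ioi 0 := fun x hx => hx.1
  have h2 : ∫ y in Ioi (0 : ℝ), g y =
      ∫ x in Ioc (0 : ℝ) 1, x ^ ((m : ℝ) + 1 / 2 - 1) * (1 - x) ^ (a - 1) := by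
    rw [hg, MeasureTheory.setIntegral_indicator measurableSet_Ioc, inter_eq_right.2 hsub]
  have h3 : ∫ x in Ioi (0 : ℝ), ((2 : ℝ) * x ^ ((2 : ℝ) - 1)) • g (x ^ (2 : ℝ)) =
      ∫ x in Ioi (0 : ℝ), (Ioc (0 : ℝ) 1).indicator
        (fun t => 2 * (t ^ (2 * m) * (1 - t ^ 2) ^ (a - 1))) x := by
    apply MeasureTheory.setIntegral_congr_fun measurableSet_Ioi
    intro x hx
    have hx0 : (0 : ℝ) < x := hx
    simp only [hg, indicator, Real.rpow_ofNat, mem_Ioc]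
    have hiff : (0 < x ^ 2 ∧ x ^ 2 ≤ 1) ↔ (0 < x ∧ x ≤ 1) := by
      constructor
      · rintro ⟨-, h⟩; exact ⟨hx0, by nlinarith⟩
      · rintro ⟨-, h⟩; exact ⟨by positivity, by nlinarith⟩
    simp only [hiff]
    split_ifs
    · have e1 : (x ^ 2) ^ ((m : ℝ) + 1 / 2 - 1) = x ^ (2 * m) / x := by
        rw [← Real.rpow_natCast x 2, ← Real.rpow_mul hx0.le,
          show ((2 : ℕ) : ℝ) * ((m : ℝ) + 1 / 2 - 1) = ((2 * m : ℕ) : ℝ) - 1 by push_cast; ring,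
          Real.rpow_sub hx0, Real.rpow_one, Real.rpow_natCast]
      rw [e1]
      norm_num
      field_simp
    · simp
  rw [h3, h2, MeasureTheory.setIntegral_indicator measurableSet_Ioc, inter_eq_right.2 hsub,
    MeasureTheory.integral_const_mul] at h1
  linarith

lemma Gamma_half (m : ℕ) : Real.Gamma (m + 1 / 2) * (4 ^ m * m.factorial) =
    √π * (2 * m).factorial := by
  induction m with
  | zero => simp [← one_div, Real.Gamma_one_half_eq]
  | succ m ih =>
    have e : ((m + 1 : ℕ) : ℝ) + 1 / 2 = ((m : ℝ) + 1 / 2) + 1 := by push_cast; ring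
    rw [e, Real.Gamma_add_one (by positivity), show 2 * (m + 1) = 2 * m + 1 + 1 by ring,
      Nat.factorial_succ, Nat.factorial_succ, Nat.factorial_succ]
    push_cast
    linear_combination ((m + 1 / 2) * 4 * (m + 1) : ℝ) * ih

lemma poisson {ν : ℝ} (hν : 1 / 2 < ν) (x : ℝ) :
    phi ν ((x / 2) ^ 2) * (√π * Real.Gamma (ν + 1 / 2)) =
      2 * ∫ t in (0 : ℝ)..1, (1 - t ^ 2) ^ (ν - 1 / 2) * Real.cos (x * t) := by
  have ha : 0 < ν + 1 / 2 := by linarith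
  have hsum : HasSum (fun m : ℕ => ∫ t in (0 : ℝ)..1, (1 - t ^ 2) ^ (ν - 1 / 2) *
      ((-1) ^ m * (x * t) ^ (2 * m) / (2 * m).factorial))
      (∫ t in (0 : ℝ)..1, (1 - t ^ 2) ^ (ν - 1 / 2) * Real.cos (x * t)) := by
    have hs : Summable fun m : ℕ => |x| ^ (2 * m) / ((2 * m).factorial : ℝ) :=
      (Real.hasSum_cosh |x|).summable
    refine intervalIntegral.hasSum_integral_of_dominated_convergence
      (fun m _ => |x| ^ (2 * m) / ((2 * m).factorial : ℝ)) ?_ ?_ ?_ ?_ ?_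
    · intro m
      apply Continuous.aestronglyMeasurable
      have : Continuous fun t : ℝ => (1 - t ^ 2) ^ (ν - 1 / 2) :=
        (by fun_prop : Continuous fun t : ℝ => 1 - t ^ 2).rpow_const (fun _ => Or.inr (by linarith))
      fun_prop
    · intro m
      filter_upwards with t ht
      rw [uIoc_of_le zero_le_one] at ht
      have h1 : 0 ≤ 1 - t ^ 2 := by nlinarith [ht.1, ht.2]
      have h2 : (1 - t ^ 2) ^ (ν - 1 / 2) ≤ 1 :=
        Real.rpow_le_one h1 (by nlinarith) (by linarith)
      have h3 : |(1 - t ^ 2) ^ (ν - 1 / 2)| ≤ 1 := by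
        rwa [abs_of_nonneg (Real.rpow_nonneg h1 _)]
      rw [Real.norm_eq_abs, abs_mul, abs_div, abs_mul, abs_pow, abs_pow, abs_neg, abs_one, one_pow,
        one_mul, Nat.abs_cast, abs_mul, abs_of_pos ht.1]
      have ht0 := ht.1.le
      calc _ ≤ 1 * ((|x| * t) ^ (2 * m) / ((2 * m).factorial : ℝ)) := by gcongr
        _ ≤ 1 * ((|x| * 1) ^ (2 * m) / ((2 * m).factorial : ℝ)) := by
          have := ht.1.le
          have := ht.2
          gcongr
        _ = _ := by simp
    · filter_upwards with t _
      exact hs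
    · exact intervalIntegrable_const
    · filter_upwards with t _
      exact (Real.hasSum_cos (x * t)).mul_left _
  rw [← hsum.tsum_eq, phi, ← tsum_mul_right, ← tsum_mul_left]
  congr 1
  ext m
  have e1 : ∀ t : ℝ, (1 - t ^ 2) ^ (ν - 1 / 2) * ((-1) ^ m * (x * t) ^ (2 * m) / (2 * m).factorial) =
      ((-1) ^ m * x ^ (2 * m) / (2 * m).factorial) *
      (t ^ (2 * m) * (1 - t ^ 2) ^ ((ν + 1 / 2) - 1)) := by
    intro t
    rw [show (ν + 1 / 2) - 1 = ν - 1 / 2 by ring, mul_pow]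
    ring
  simp only [e1]
  rw [intervalIntegral.integral_const_mul, moment ha]
  have h2 := Gamma_half m
  have e2 : (m : ℝ) + 1 / 2 + (ν + 1 / 2) = m + ν + 1 := by ring
  rw [e2]
  have hf : ((2 * m).factorial : ℝ) ≠ 0 := by exact_mod_cast Nat.factorial_ne_zero _
  have hf' : (m.factorial : ℝ) ≠ 0 := by exact_mod_cast Nat.factorial_ne_zero _
  have e3 : Real.Gamma (m + 1 / 2) = √π * (2 * m).factorial / (4 ^ m * m.factorial) := by
    rw [← h2]; field_simp
  have e4 : (-(x / 2) ^ 2) ^ m = (-1) ^ m * x ^ (2 * m) / 4 ^ m := by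
    rw [neg_pow, ← pow_mul, div_pow, pow_mul 2 2 m]; norm_num; ring
  rw [e3, e4]
  field_simp

lemma ofReal_mul_cpow {r : ℝ} (hr : 0 < r) {w : ℂ} (hw : w ≠ 0) (p : ℝ) :
    ((r : ℂ) * w) ^ (p : ℂ) = ((r ^ p : ℝ) : ℂ) * w ^ (p : ℂ) := by
  have hr' : (r : ℂ) ≠ 0 := by exact_mod_cast hr.ne'
  rw [Complex.cpow_def_of_ne_zero (mul_ne_zero hr' hw), Complex.cpow_def_of_ne_zero hw,
    Complex.log_ofReal_mul hr hw, add_mul, Complex.exp_add, Real.rpow_def_of_pos hr]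
  push_cast
  rfl

/-- The contour integral over the unit square. -/
lemma contour {p x : ℝ} (hp : 0 < p) :
    (∫ t in (0 : ℝ)..1, (1 - t ^ 2) ^ p * Real.cos (x * t)) =
      (∫ t in (0 : ℝ)..1, (1 - ((t : ℂ) + Complex.I) ^ 2) ^ (p : ℂ) *
        Complex.exp (x * ((t : ℂ) + Complex.I) * Complex.I)).re
      - (Complex.I * ∫ s in (0 : ℝ)..1, ((s : ℂ) ^ 2 - 2 * Complex.I * s) ^ (p : ℂ) *
        (Complex.exp (x * Complex.I) * Real.exp (-(x * s)))).re := by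
  have hp' : 0 < (p : ℂ).re := by simpa
  have key := Complex.integral_boundary_rect_eq_zero_of_continuousOn_of_differentiableOn
    (fun z : ℂ => (1 - z ^ 2) ^ (p : ℂ) * Complex.exp (x * z * Complex.I)) 0 (1 + Complex.I) ?_ ?_
  rotate_left
  · intro z hz
    simp [Complex.mem_reProdIm] at hz
    obtain ⟨⟨h1, h2⟩, h3, h4⟩ := hz
    apply ContinuousAt.continuousWithinAt
    apply ContinuousAt.mul
    · have h5 : ContinuousAt (fun w : ℂ => w ^ (p : ℂ)) (1 - z ^ 2) := by
        apply Complex.continuousAt_cpow_const_of_re_pos _ hp'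
        left
        simp [pow_two]
        nlinarith
      exact ContinuousAt.comp (f := fun z : ℂ => 1 - z ^ 2) h5 (by fun_prop)
    · fun_prop
  · intro z hz
    simp [Complex.mem_reProdIm] at hz
    obtain ⟨⟨h1, h2⟩, h3, h4⟩ := hz
    apply DifferentiableAt.differentiableWithinAt
    apply DifferentiableAt.mul
    · apply DifferentiableAt.cpow_const
      · fun_prop
      · left
        simp [pow_two]
        nlinarith
    · fun_prop
  simp only [Complex.zero_re, Complex.zero_im, Complex.add_re, Complex.add_im, Complex.one_re,
    Complex.one_im, Complex.I_re, Complex.I_im, Complex.ofReal_zero, Complex.ofReal_one, add_zero,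
    zero_add, zero_mul, one_mul, smul_eq_mul] at key
  have hb : (∫ t in (0 : ℝ)..1, (1 - t ^ 2) ^ p * Real.cos (x * t)) =
      (∫ t in (0 : ℝ)..1, (1 - (t : ℂ) ^ 2) ^ (p : ℂ) * Complex.exp (x * t * Complex.I)).re := by
    have hi : IntervalIntegrable (fun t : ℝ => (1 - (t : ℂ) ^ 2) ^ (p : ℂ) *
        Complex.exp (x * t * Complex.I)) MeasureTheory.volume 0 1 := by
      apply ContinuousOn.intervalIntegrable
      intro t ht
      rw [uIcc_of_le zero_le_one] at ht
      apply ContinuousAt.continuousWithinAt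
      apply ContinuousAt.mul
      · have h5 : ContinuousAt (fun w : ℂ => w ^ (p : ℂ)) (1 - (t : ℂ) ^ 2) := by
          apply Complex.continuousAt_cpow_const_of_re_pos _ hp'
          left
          simp [pow_two]
          nlinarith [ht.1, ht.2]
        exact ContinuousAt.comp (f := fun t : ℝ => 1 - (t : ℂ) ^ 2) h5 (by fun_prop)
      · fun_prop
    have := Complex.reCLM.intervalIntegral_comp_comm hi
    simp only [Complex.reCLM_apply] at this
    rw [← this]
    apply intervalIntegral.integral_congr
    intro t ht
    rw [uIcc_of_le zero_le_one] at ht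
    have h1 : 0 ≤ 1 - t ^ 2 := by nlinarith [ht.1, ht.2]
    have h2 : (1 - (t : ℂ) ^ 2) ^ (p : ℂ) = (((1 - t ^ 2) ^ p : ℝ) : ℂ) := by
      rw [Complex.ofReal_cpow h1]; push_cast; rfl
    simp only
    rw [h2, ← Complex.ofReal_mul, Complex.re_ofReal_mul, Complex.exp_ofReal_mul_I_re]
  have hl : (∫ y in (0 : ℝ)..1, (1 - ((y : ℂ) * Complex.I) ^ 2) ^ (p : ℂ) *
      Complex.exp (x * (y * Complex.I) * Complex.I)) =
      ((∫ y in (0 : ℝ)..1, (1 + y ^ 2) ^ p * Real.exp (-(x * y)) : ℝ) : ℂ) := by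
    rw [← intervalIntegral.integral_ofReal]
    congr 1
    ext y
    have e1 : 1 - ((y : ℂ) * Complex.I) ^ 2 = ((1 + y ^ 2 : ℝ) : ℂ) := by
      rw [mul_pow, Complex.I_sq]; push_cast; ring
    have e2 : (x : ℂ) * (y * Complex.I) * Complex.I = ((-(x * y) : ℝ) : ℂ) := by
      push_cast
      linear_combination (x * y : ℂ) * Complex.I_sq
    rw [e1, e2, ← Complex.ofReal_cpow (by positivity)]
    push_cast
    rfl
  have hr : (∫ y in (0 : ℝ)..1, (1 - (1 + (y : ℂ) * Complex.I) ^ 2) ^ (p : ℂ) *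
      Complex.exp (x * (1 + y * Complex.I) * Complex.I)) =
      ∫ s in (0 : ℝ)..1, ((s : ℂ) ^ 2 - 2 * Complex.I * s) ^ (p : ℂ) *
        (Complex.exp (x * Complex.I) * Real.exp (-(x * s))) := by
    congr 1
    ext y
    have e1 : 1 - (1 + (y : ℂ) * Complex.I) ^ 2 = (y : ℂ) ^ 2 - 2 * Complex.I * y := by
      linear_combination -(y ^ 2 : ℂ) * Complex.I_sq
    have e2 : (x : ℂ) * (1 + y * Complex.I) * Complex.I = x * Complex.I + ((-(x * y) : ℝ) : ℂ) := by
      push_cast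
      linear_combination (x * y : ℂ) * Complex.I_sq
    rw [e1, e2, Complex.exp_add, Complex.ofReal_exp]
  rw [hl, hr] at key
  have k2 := congrArg Complex.re key
  simp only [Complex.add_re, Complex.sub_re, Complex.zero_re] at k2
  rw [hb]
  have k3 : (Complex.I * ((∫ y in (0 : ℝ)..1, (1 + y ^ 2) ^ p * Real.exp (-(x * y)) : ℝ) : ℂ)).re = 0 := by
    simp
  rw [k3] at k2
  linarith

lemma contour_top {p : ℝ} (hp : 0 < p) : Tendsto (fun x : ℝ => x ^ (p + 1) *
      (∫ t in (0 : ℝ)..1, (1 - ((t : ℂ) + Complex.I) ^ 2) ^ (p : ℂ) *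
        Complex.exp (x * ((t : ℂ) + Complex.I) * Complex.I)).re) atTop (𝓝 0) := by
  have h0 : Tendsto (fun x : ℝ => 5 ^ p * (x ^ (p + 1) * Real.exp (-1 * x))) atTop (𝓝 0) := by
    simpa using (tendsto_rpow_mul_exp_neg_mul_atTop_nhds_zero (p + 1) 1 one_pos).const_mul (5 ^ p)
  refine squeeze_zero_norm' ?_ h0
  filter_upwards [eventually_gt_atTop 0] with x hx
  rw [norm_mul, Real.norm_eq_abs, abs_of_nonneg (by positivity)]
  have : ‖∫ t in (0 : ℝ)..1, (1 - ((t : ℂ) + Complex.I) ^ 2) ^ (p : ℂ) *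
        Complex.exp (x * ((t : ℂ) + Complex.I) * Complex.I)‖ ≤ 5 ^ p * Real.exp (-1 * x) * |1 - 0| := by
    apply intervalIntegral.norm_integral_le_of_norm_le_const
    intro t ht
    rw [uIoc_of_le zero_le_one] at ht
    rw [norm_mul, Complex.norm_cpow_real, Complex.norm_exp]
    have e : ((x : ℂ) * ((t : ℂ) + Complex.I) * Complex.I).re = -1 * x := by simp
    rw [e]
    have h1 : ‖(t : ℂ) + Complex.I‖ ≤ 2 := by
      refine (norm_add_le _ _).trans ?_
      rw [Complex.norm_real, Complex.norm_I, Real.norm_eq_abs, abs_of_pos ht.1]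
      linarith [ht.2]
    have h2 : ‖1 - ((t : ℂ) + Complex.I) ^ 2‖ ≤ 5 := by
      refine (norm_sub_le _ _).trans ?_
      rw [norm_pow, norm_one]
      nlinarith [norm_nonneg ((t : ℂ) + Complex.I)]
    gcongr
  have h3 := (Complex.abs_re_le_norm _).trans this
  rw [Real.norm_eq_abs]
  calc _ ≤ x ^ (p + 1) * (5 ^ p * Real.exp (-1 * x) * |1 - 0|) := by gcongr
    _ = _ := by simp; ring

lemma contour_right {p : ℝ} (hp : 0 < p) : Tendsto (fun x : ℝ => ((x ^ (p + 1) : ℝ) : ℂ) *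
      ∫ s in (0 : ℝ)..1, ((s : ℂ) ^ 2 - 2 * Complex.I * s) ^ (p : ℂ) *
        (Real.exp (-(x * s)) : ℂ)) atTop
      (𝓝 ((-(2 * Complex.I)) ^ (p : ℂ) * Real.Gamma (p + 1))) := by
  have hI : (-(2 * Complex.I)) ≠ 0 := by simp
  have hlim : ∫ t in Ioi (0 : ℝ), (-(2 * Complex.I) * t) ^ (p : ℂ) * (Real.exp (-t) : ℂ) =
      (-(2 * Complex.I)) ^ (p : ℂ) * Real.Gamma (p + 1) := by
    rw [Real.Gamma_eq_integral (by linarith), ← integral_complex_ofReal,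
      ← MeasureTheory.integral_const_mul]
    apply MeasureTheory.setIntegral_congr_fun measurableSet_Ioi
    intro t ht
    simp only
    rw [mul_comm _ (t : ℂ), ofReal_mul_cpow ht hI, show p + 1 - 1 = p by ring]
    push_cast
    ring
  rw [← hlim]
  have hcong : ∀ᶠ x : ℝ in atTop, (∫ t in Ioi (0 : ℝ), (Iic x).indicator (fun t : ℝ =>
      ((t : ℂ) ^ 2 * (x⁻¹ : ℝ) - 2 * Complex.I * t) ^ (p : ℂ) * (Real.exp (-t) : ℂ)) t) =
      ((x ^ (p + 1) : ℝ) : ℂ) *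
      ∫ s in (0 : ℝ)..1, ((s : ℂ) ^ 2 - 2 * Complex.I * s) ^ (p : ℂ) *
        (Real.exp (-(x * s)) : ℂ) := by
    filter_upwards [eventually_gt_atTop 0] with x hx
    rw [MeasureTheory.setIntegral_indicator measurableSet_Iic, Ioi_inter_Iic,
      ← intervalIntegral.integral_of_le hx.le]
    have h1 := intervalIntegral.integral_comp_mul_left (a := 0) (b := 1) (fun t : ℝ =>
      ((t : ℂ) ^ 2 * (x⁻¹ : ℝ) - 2 * Complex.I * t) ^ (p : ℂ) * (Real.exp (-t) : ℂ)) hx.ne'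
    rw [mul_zero, mul_one] at h1
    have h2 : (∫ t in (0 : ℝ)..x,
      ((t : ℂ) ^ 2 * (x⁻¹ : ℝ) - 2 * Complex.I * t) ^ (p : ℂ) * (Real.exp (-t) : ℂ)) =
      (x : ℂ) * (x⁻¹ • ∫ t in (0 : ℝ)..x,
      ((t : ℂ) ^ 2 * (x⁻¹ : ℝ) - 2 * Complex.I * t) ^ (p : ℂ) * (Real.exp (-t) : ℂ)) := by
      rw [Complex.real_smul, ← mul_assoc, ← Complex.ofReal_mul, mul_inv_cancel₀ hx.ne']
      simp
    rw [h2, ← h1, ← intervalIntegral.integral_const_mul, ← intervalIntegral.integral_const_mul]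
    apply intervalIntegral.integral_congr_ae
    filter_upwards with s hs
    rw [uIoc_of_le zero_le_one] at hs
    have hx' : (x : ℂ) ≠ 0 := by exact_mod_cast hx.ne'
    have e : (((x * s : ℝ) : ℂ) ^ 2 * (x⁻¹ : ℝ) - 2 * Complex.I * ((x * s : ℝ) : ℂ)) =
        (x : ℂ) * ((s : ℂ) ^ 2 - 2 * Complex.I * s) := by
      push_cast; field_simp
    have hne : ((s : ℂ) ^ 2 - 2 * Complex.I * s) ≠ 0 := by
      intro h
      have := congrArg Complex.im h
      simp [pow_two] at this
      exact hs.1.ne' this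
    rw [e, ofReal_mul_cpow hx hne, Real.rpow_add hx, Real.rpow_one]
    push_cast
    ring
  refine Tendsto.congr' hcong ?_
  refine MeasureTheory.tendsto_integral_filter_of_dominated_convergence
    (fun t => 3 ^ p * (Real.exp (-t) * t ^ (p + 1 - 1) + Real.exp (-t) * t ^ (2 * p + 1 - 1))) ?_ ?_ ?_ ?_
  · filter_upwards with x
    apply MeasureTheory.AEStronglyMeasurable.indicator _ measurableSet_Iic
    apply Measurable.aestronglyMeasurable
    fun_prop
  · filter_upwards [eventually_ge_atTop 1] with x hx
    filter_upwards [MeasureTheory.ae_restrict_mem measurableSet_Ioi] with t ht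
    have ht' : 0 < t := ht
    refine (norm_indicator_le_norm_self _ _).trans ?_
    rw [norm_mul, Complex.norm_cpow_real, Complex.norm_real, Real.norm_eq_abs, Real.abs_exp]
    have hx1 : x⁻¹ ≤ 1 := inv_le_one_of_one_le₀ hx
    have hn : ‖(t : ℂ) ^ 2 * (x⁻¹ : ℝ) - 2 * Complex.I * t‖ ≤ t ^ 2 + 2 * t := by
      refine (norm_sub_le _ _).trans ?_
      simp only [norm_mul, norm_pow, Complex.norm_real, Complex.norm_I, Real.norm_eq_abs,
        abs_of_pos ht', Complex.norm_ofNat]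
      rw [abs_of_pos (by positivity : 0 < x⁻¹)]
      nlinarith [sq_nonneg t]
    have h1 : ‖(t : ℂ) ^ 2 * (x⁻¹ : ℝ) - 2 * Complex.I * t‖ ^ p ≤ 3 ^ p * (t ^ p + t ^ (2 * p)) := by
      have e : t ^ (2 * p) = (t ^ 2) ^ p := by
        rw [Real.rpow_mul ht'.le]; norm_num
      rcases le_total t 1 with h | h
      · calc _ ≤ (3 * t) ^ p := by
              apply Real.rpow_le_rpow (norm_nonneg _) _ hp.le
              nlinarith
          _ = 3 ^ p * t ^ p := Real.mul_rpow (by norm_num) ht'.le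
          _ ≤ _ := by
            have : 0 ≤ t ^ (2 * p) := by positivity
            gcongr
            linarith
      · calc _ ≤ (3 * t ^ 2) ^ p := by
              apply Real.rpow_le_rpow (norm_nonneg _) _ hp.le
              nlinarith
          _ = 3 ^ p * t ^ (2 * p) := by rw [Real.mul_rpow (by norm_num) (by positivity), e]
          _ ≤ _ := by
            have : 0 ≤ t ^ p := by positivity
            gcongr
            linarith
    rw [show p + 1 - 1 = p by ring, show 2 * p + 1 - 1 = 2 * p by ring]
    calc _ ≤ 3 ^ p * (t ^ p + t ^ (2 * p)) * Real.exp (-t) := by gcongr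
      _ = _ := by ring
  · exact ((Real.GammaIntegral_convergent (by linarith)).add
      (Real.GammaIntegral_convergent (by linarith))).const_mul _
  · filter_upwards [MeasureTheory.ae_restrict_mem measurableSet_Ioi] with t ht
    have ht' : 0 < t := ht
    have h1 : Tendsto (fun x : ℝ => (t : ℂ) ^ 2 * (x⁻¹ : ℝ) - 2 * Complex.I * t) atTop
        (𝓝 (-(2 * Complex.I) * t)) := by
      have := ((Complex.continuous_ofReal.tendsto 0).comp tendsto_inv_atTop_zero).const_mul ((t : ℂ) ^ 2)
      have := this.sub_const (2 * Complex.I * t)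
      simpa using this
    have h2 : ContinuousAt (fun w : ℂ => w ^ (p : ℂ)) (-(2 * Complex.I) * t) := by
      apply Complex.continuousAt_cpow_const_of_re_pos
      · right
        simp
        exact ht'.ne'
      · simpa
    refine ((h2.tendsto.comp h1).mul_const (Real.exp (-t) : ℂ)).congr' ?_
    filter_upwards [eventually_ge_atTop t] with x hx
    rw [indicator_of_mem (by exact hx)]
    rfl

/-- Leading-order asymptotics of the Bessel function at infinity. -/
def Asym (ν : ℝ) : Prop :=
  Tendsto (fun x => √x * besselJ ν x - √(2 / π) * Real.cos (x - ν * π / 2 - π / 4)) atTop (𝓝 0)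

lemma neg_two_I_cpow (p : ℝ) : (-(2 * Complex.I)) ^ (p : ℂ) =
    ((2 ^ p : ℝ) : ℂ) * Complex.exp ((-(π / 2 * p) : ℝ) * Complex.I) := by
  have h := ofReal_mul_cpow two_pos (neg_ne_zero.mpr Complex.I_ne_zero) p
  have e : -(2 * Complex.I) = ((2 : ℝ) : ℂ) * -Complex.I := by push_cast; ring
  rw [e, h, Complex.cpow_def_of_ne_zero (neg_ne_zero.mpr Complex.I_ne_zero), Complex.log_neg_I]
  congr 2
  push_cast
  ring

lemma asym_large {ν : ℝ} (hν : 1 / 2 < ν) : Asym ν := by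
  obtain ⟨p, rfl⟩ : ∃ p, ν = p + 1 / 2 := ⟨ν - 1 / 2, by ring⟩
  have hp : 0 < p := by linarith
  set K : ℝ := 2 * (2 ^ (p + 1 / 2))⁻¹ / (√π * Real.Gamma (p + 1)) with hK
  have hG : 0 < Real.Gamma (p + 1) := Real.Gamma_pos_of_pos (by linarith)
  have hπ : 0 < √π := Real.sqrt_pos.mpr Real.pi_pos
  set G0 : ℂ := (-(2 * Complex.I)) ^ (p : ℂ) * Real.Gamma (p + 1) with hG0
  have h1 := (contour_top hp).const_mul K
  have h2 := (contour_right hp).sub_const G0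
  rw [sub_self] at h2
  have h3 : Tendsto (fun x : ℝ => (Complex.I * Complex.exp (x * Complex.I) * (((x ^ (p + 1) : ℝ) : ℂ) *
      (∫ s in (0 : ℝ)..1, ((s : ℂ) ^ 2 - 2 * Complex.I * s) ^ (p : ℂ) *
        (Real.exp (-(x * s)) : ℂ)) - G0)).re) atTop (𝓝 0) := by
    refine squeeze_zero_norm (fun x => ?_) (tendsto_zero_iff_norm_tendsto_zero.mp h2)
    refine (Complex.abs_re_le_norm _).trans ?_
    rw [norm_mul, norm_mul, Complex.norm_I, Complex.norm_exp_ofReal_mul_I, one_mul, one_mul]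
  have h4 := h1.sub (h3.const_mul K)
  rw [mul_zero, sub_zero] at h4
  refine h4.congr' ?_
  filter_upwards [eventually_gt_atTop 0] with x hx
  have hP := poisson hν x
  rw [show p + 1 / 2 + 1 / 2 = p + 1 by ring, show p + 1 / 2 - 1 / 2 = p by ring] at hP
  have hC := contour (x := x) hp
  have e1 : (∫ s in (0 : ℝ)..1, ((s : ℂ) ^ 2 - 2 * Complex.I * s) ^ (p : ℂ) *
        (Complex.exp (x * Complex.I) * Real.exp (-(x * s)))) = Complex.exp (x * Complex.I) *
      ∫ s in (0 : ℝ)..1, ((s : ℂ) ^ 2 - 2 * Complex.I * s) ^ (p : ℂ) * (Real.exp (-(x * s)) : ℂ) := by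
    rw [← intervalIntegral.integral_const_mul]
    congr 1
    ext s
    ring
  rw [e1] at hC
  set T := (∫ t in (0 : ℝ)..1, (1 - ((t : ℂ) + Complex.I) ^ 2) ^ (p : ℂ) *
        Complex.exp (x * ((t : ℂ) + Complex.I) * Complex.I)).re
  set R := ∫ s in (0 : ℝ)..1, ((s : ℂ) ^ 2 - 2 * Complex.I * s) ^ (p : ℂ) * (Real.exp (-(x * s)) : ℂ)
  have e2 : (Complex.I * Complex.exp (x * Complex.I) * (((x ^ (p + 1) : ℝ) : ℂ) * R - G0)).re =
      x ^ (p + 1) * (Complex.I * (Complex.exp (x * Complex.I) * R)).re -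
        (Complex.I * Complex.exp (x * Complex.I) * G0).re := by
    rw [← Complex.re_ofReal_mul, ← Complex.sub_re]
    congr 1
    ring
  have e3 : K * (Complex.I * Complex.exp (x * Complex.I) * G0).re =
      - (√(2 / π) * Real.cos (x - (p + 1 / 2) * π / 2 - π / 4)) := by
    have : Complex.I * Complex.exp (x * Complex.I) * G0 =
        ((2 ^ p * Real.Gamma (p + 1) : ℝ) : ℂ) *
          -Complex.exp ((x - (p + 1 / 2) * π / 2 - π / 4 : ℝ) * Complex.I) := by
      rw [hG0, neg_two_I_cpow]
      have : Complex.exp ((x - (p + 1 / 2) * π / 2 - π / 4 : ℝ) * Complex.I) =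
          Complex.exp (x * Complex.I) * Complex.exp ((-(π / 2 * p) : ℝ) * Complex.I) * -Complex.I := by
        rw [← Complex.exp_neg_pi_div_two_mul_I, ← Complex.exp_add, ← Complex.exp_add]
        congr 1
        push_cast
        ring
      rw [this]
      push_cast
      ring
    rw [this, Complex.re_ofReal_mul, Complex.neg_re, Complex.exp_ofReal_mul_I_re, hK]
    have e5 : √(2 / π) = 2 * (2 ^ (p + 1 / 2) : ℝ)⁻¹ * 2 ^ p / √π := by
      rw [Real.sqrt_div two_pos.le, Real.rpow_add two_pos, ← Real.sqrt_eq_rpow]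
      have : √2 * √2 = (2 : ℝ) := Real.mul_self_sqrt two_pos.le
      have h2 : 0 < √(2 : ℝ) := by positivity
      field_simp
      linarith
    rw [e5]
    field_simp
  have e4 : √x * besselJ (p + 1 / 2) x = K * (x ^ (p + 1) *
      (T - (Complex.I * (Complex.exp (x * Complex.I) * R)).re)) := by
    rw [← hC, besselJ_eq _ _ hx, Real.div_rpow hx.le two_pos.le, hK]
    have e6 : x ^ (p + 1) = √x * x ^ (p + 1 / 2) := by
      rw [Real.sqrt_eq_rpow, ← Real.rpow_add hx]
      congr 1
      ring
    rw [e6]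
    generalize phi (p + 1 / 2) ((x / 2) ^ 2) = F at *
    generalize (∫ t in (0 : ℝ)..1, (1 - t ^ 2) ^ p * Real.cos (x * t)) = E at *
    field_simp
    linear_combination hP
  rw [e4, e2, mul_sub K (_ * _) _, e3]
  ring

lemma asym_down {ν : ℝ} (h1 : Asym (ν + 1)) (h2 : Asym (ν + 2)) : Asym ν := by
  unfold Asym at *
  have h3 : Tendsto (fun x : ℝ => 2 * (ν + 1) * x⁻¹) atTop (𝓝 0) := by
    simpa using tendsto_inv_atTop_zero.const_mul (2 * (ν + 1))
  have h4 : Tendsto (fun x : ℝ => 2 * (ν + 1) * x⁻¹ *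
      (√(2 / π) * Real.cos (x - (ν + 1) * π / 2 - π / 4))) atTop (𝓝 0) := by
    refine squeeze_zero_norm (a := fun x : ℝ => ‖2 * (ν + 1) * x⁻¹‖ * √(2 / π)) (fun x => ?_) ?_
    · rw [norm_mul, norm_mul (√(2 / π)), Real.norm_eq_abs (√(2 / π)), abs_of_nonneg (by positivity)]
      have := Real.abs_cos_le_one (x - (ν + 1) * π / 2 - π / 4)
      gcongr
      exact mul_le_of_le_one_right (by positivity) this
    · simpa using h3.norm.mul_const (√(2 / π))
  have h5 := ((h3.mul h1).add h4).sub h2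
  simp only [mul_zero, add_zero, sub_zero] at h5
  refine h5.congr' ?_
  filter_upwards [eventually_gt_atTop 0] with x hx
  rw [besselJ_rec ν x hx, show x - (ν + 2) * π / 2 - π / 4 = x - ν * π / 2 - π / 4 - π by ring,
    Real.cos_sub_pi]
  field_simp
  ring

lemma asym (ν : ℝ) : Asym ν := by
  have : ∀ n : ℕ, ∀ ν : ℝ, 1 / 2 - n < ν → Asym ν := by
    intro n
    induction n with
    | zero => intro ν h; exact asym_large (by simpa using h)
    | succ n ih =>
      intro ν h
      push_cast at h
      exact asym_down (ih _ (by linarith)) (ih _ (by linarith))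
  obtain ⟨n, hn⟩ := exists_nat_gt (1 / 2 - ν)
  exact this n ν (by linarith)

/-- The amplitude of `√x J_ν`. -/
noncomputable def uJ (ν x : ℝ) : ℝ := √x * besselJ ν x

noncomputable def vJ (ν x : ℝ) : ℝ := √x * ((ν + 1 / 2) / x * besselJ ν x - besselJ (ν + 1) x)

lemma sol_of_asym {c A θ : ℝ} {u v : ℝ → ℝ} (du : ∀ x, 0 < x → HasDerivAt u (v x) x)
    (dv : ∀ x, 0 < x → HasDerivAt v (-(1 - c / x ^ 2) * u x) x)
    (hu : Tendsto (fun x => u x - A * Real.sin (x + θ)) atTop (𝓝 0))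
    (hv : Tendsto (fun x => v x - A * Real.cos (x + θ)) atTop (𝓝 0)) :
    Sol c (A * Complex.exp (θ * Complex.I)) u v := by
  refine ⟨du, dv, ?_⟩
  rw [tendsto_iff_norm_sub_tendsto_zero]
  have h := hv.norm.add hu.norm
  simp only [norm_zero, add_zero] at h
  refine squeeze_zero (fun _ => norm_nonneg _) (fun x => ?_) h
  have e : ((v x : ℂ) + u x * Complex.I) * Complex.exp (-((x : ℂ) * Complex.I)) -
      A * Complex.exp (θ * Complex.I) =
      (((v x - A * Real.cos (x + θ) : ℝ) : ℂ) + ((u x - A * Real.sin (x + θ) : ℝ) : ℂ) * Complex.I) *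
        Complex.exp ((-x : ℝ) * Complex.I) := by
    have e1 : Complex.exp (θ * Complex.I) = (Complex.cos ((x + θ : ℝ) : ℂ) +
        Complex.sin ((x + θ : ℝ) : ℂ) * Complex.I) * Complex.exp ((-x : ℝ) * Complex.I) := by
      rw [← Complex.exp_mul_I, ← Complex.exp_add]
      congr 1
      push_cast
      ring
    rw [e1]
    push_cast
    rw [neg_mul]
    ring
  rw [e, norm_mul, Complex.norm_exp_ofReal_mul_I, mul_one]
  refine (norm_add_le _ _).trans ?_
  rw [norm_mul, Complex.norm_I, mul_one, Complex.norm_real, Complex.norm_real]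

lemma sol_J (ν : ℝ) : Sol (ν ^ 2 - 1 / 4)
    ((√(2 / π) : ℝ) * Complex.exp ((π / 4 - ν * π / 2 : ℝ) * Complex.I)) (uJ ν) (vJ ν) := by
  apply sol_of_asym
  · intro x hx
    refine ((Real.hasDerivAt_sqrt hx.ne').mul (besselJ_hasDerivAt ν x hx)).congr_deriv ?_
    have hs : √x * √x = x := Real.mul_self_sqrt hx.le
    have hs0 : 0 < √x := Real.sqrt_pos.mpr hx
    rw [vJ]
    have : x = √x ^ 2 := by rw [pow_two, hs]
    generalize √x = s at *
    subst this
    field_simp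
    ring
  · intro x hx
    have h1 := ((hasDerivAt_inv hx.ne').const_mul (ν + 1 / 2)).mul (besselJ_hasDerivAt ν x hx)
    have h2 := (Real.hasDerivAt_sqrt hx.ne').mul (h1.sub (besselJ_hasDerivAt (ν + 1) x hx))
    have h3 := h2.congr_of_eventuallyEq (f₁ := vJ ν) (Eventually.of_forall fun y => by
      simp [vJ, div_eq_mul_inv])
    refine h3.congr_deriv ?_
    have hr := besselJ_rec ν x hx
    rw [show ν + 1 + 1 = ν + 2 by ring]
    have hr' : besselJ (ν + 2) x = 2 * (ν + 1) / x * besselJ (ν + 1) x - besselJ ν x := by linarith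
    have hs : √x * √x = x := Real.mul_self_sqrt hx.le
    have hs0 : 0 < √x := Real.sqrt_pos.mpr hx
    rw [hr', uJ]
    simp only [Pi.mul_apply, Pi.sub_apply]
    have : x = √x ^ 2 := by rw [pow_two, hs]
    generalize besselJ ν x = j at *
    generalize besselJ (ν + 1) x = j at *
    generalize √x = s at *
    subst this
    field_simp
    ring
  · refine (asym ν).congr fun x => ?_
    rw [uJ, ← Real.cos_sub_pi_div_two]
    ring_nf
  · have h1 := asym ν
    have h2 := asym (ν + 1)
    have h3 : Tendsto (fun x : ℝ => (ν + 1 / 2) * x⁻¹) atTop (𝓝 0) := by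
      simpa using tendsto_inv_atTop_zero.const_mul (ν + 1 / 2)
    have h4 : Tendsto (fun x : ℝ => (ν + 1 / 2) * x⁻¹ *
        (√(2 / π) * Real.cos (x - ν * π / 2 - π / 4))) atTop (𝓝 0) := by
      refine squeeze_zero_norm (a := fun x : ℝ => ‖(ν + 1 / 2) * x⁻¹‖ * √(2 / π)) (fun x => ?_) ?_
      · rw [norm_mul, norm_mul (√(2 / π)), Real.norm_eq_abs (√(2 / π)), abs_of_nonneg (by positivity)]
        have := Real.abs_cos_le_one (x - ν * π / 2 - π / 4)
        gcongr
        exact mul_le_of_le_one_right (by positivity) this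
      · simpa using h3.norm.mul_const (√(2 / π))
    have h5 := ((h3.mul h1).add h4).sub h2
    simp only [mul_zero, add_zero, sub_zero] at h5
    refine h5.congr fun x => ?_
    rw [vJ, show x - (ν + 1) * π / 2 - π / 4 = x + (π / 4 - ν * π / 2) - π by ring, Real.cos_sub_pi]
    ring

/-- The forcing term of the Volterra form of the equation. -/
noncomputable def forcing (c : ℝ) (u : ℝ → ℝ) (t : ℝ) : ℂ :=
  ((c / t ^ 2 * u t : ℝ) : ℂ) * Complex.exp (-((t : ℂ) * Complex.I))

lemma norm_forcing (c : ℝ) (u : ℝ → ℝ) (t : ℝ) : ‖forcing c u t‖ = |c / t ^ 2 * u t| := by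
  rw [forcing, norm_mul, ← neg_mul, ← Complex.ofReal_neg, Complex.norm_exp_ofReal_mul_I, mul_one,
    Complex.norm_real, Real.norm_eq_abs]

lemma Sol.forcing_le {c : ℝ} {a : ℂ} {u v : ℝ → ℝ} (h : Sol c a u v) {x t C A : ℝ} (hx : 0 < x)
    (ht : x ≤ t) (hC : |c| ≤ C) (hA : ‖a‖ ≤ A) :
    ‖forcing c u t‖ ≤ C * (A * Real.exp (C / x)) * t ^ (-2 : ℝ) := by
  have ht0 : 0 < t := hx.trans_le ht
  have hC0 : 0 ≤ C := (abs_nonneg _).trans hC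
  have hA0 : 0 ≤ A := (norm_nonneg _).trans hA
  have h1 := h.energy_le t ht0
  have hu : |u t| ≤ A * Real.exp (C / x) := by
    apply abs_le_of_sq_le_sq _ (by positivity)
    have h2 : Real.exp (|c| / t) ≤ Real.exp (C / x) := by
      apply Real.exp_le_exp.mpr
      gcongr
    have h3 : 1 ≤ Real.exp (C / x) := Real.one_le_exp (by positivity)
    calc u t ^ 2 ≤ ‖a‖ ^ 2 * Real.exp (|c| / t) := by nlinarith [sq_nonneg (v t)]
      _ ≤ A ^ 2 * Real.exp (C / x) := by gcongr
      _ ≤ A ^ 2 * (Real.exp (C / x) * Real.exp (C / x)) := by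
        gcongr
        nlinarith
      _ = _ := by ring
  rw [norm_forcing, abs_mul, abs_div, abs_of_pos (by positivity : 0 < t ^ 2),
    Real.rpow_neg ht0.le, Real.rpow_two, div_eq_mul_inv]
  calc _ ≤ C * (t ^ 2)⁻¹ * (A * Real.exp (C / x)) := by gcongr
    _ = _ := by ring

lemma forcing_continuousAt {c : ℝ} {u : ℝ → ℝ} {t : ℝ} (ht : 0 < t) (hu : ContinuousAt u t) :
    ContinuousAt (forcing c u) t := by
  unfold forcing
  have h2 : ContinuousAt (fun t => c / t ^ 2) t := by
    apply ContinuousAt.div (by fun_prop) (by fun_prop) (by positivity)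
  have h1 : ContinuousAt (fun t => c / t ^ 2 * u t) t := h2.mul hu
  exact (Complex.continuous_ofReal.continuousAt.comp h1).mul (by fun_prop)

lemma Sol.forcing_meas {c : ℝ} {a : ℂ} {u v : ℝ → ℝ} (h : Sol c a u v) {x : ℝ} (hx : 0 < x) :
    MeasureTheory.AEStronglyMeasurable (forcing c u) (MeasureTheory.volume.restrict (Ioi x)) := by
  apply ContinuousOn.aestronglyMeasurable _ measurableSet_Ioi
  intro t ht
  have ht' : 0 < t := hx.trans ht
  exact (forcing_continuousAt ht' (h.du t ht').continuousAt).continuousWithinAt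

lemma integrable_bound (B : ℝ) {x : ℝ} (hx : 0 < x) :
    MeasureTheory.IntegrableOn (fun t : ℝ => B * t ^ (-2 : ℝ)) (Ioi x) :=
  (integrableOn_Ioi_rpow_of_lt (by norm_num) hx).const_mul B

lemma Sol.volterra {c : ℝ} {a : ℂ} {u v : ℝ → ℝ} (h : Sol c a u v) {x : ℝ} (hx : 0 < x) :
    ∫ t in Ioi x, forcing c u t =
      a - ((v x : ℂ) + (u x : ℂ) * Complex.I) * Complex.exp (-((x : ℂ) * Complex.I)) := by
  have hd : ∀ t, 0 < t → HasDerivAt (fun x : ℝ => ((v x : ℂ) + (u x : ℂ) * Complex.I) *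
      Complex.exp (-((x : ℂ) * Complex.I))) (forcing c u t) t := by
    intro t ht
    have h1 := (h.dv t ht).ofReal_comp.add ((h.du t ht).ofReal_comp.mul_const Complex.I)
    have h2 : HasDerivAt (fun x : ℝ => Complex.exp (-((x : ℂ) * Complex.I)))
        (Complex.exp (-((t : ℂ) * Complex.I)) * (-(1 * Complex.I))) t := by
      have := (((hasDerivAt_id t).ofReal_comp).mul_const Complex.I).neg.cexp
      simpa using this
    refine (h1.mul h2).congr_deriv ?_
    simp only [forcing, Pi.add_apply]
    push_cast
    linear_combination (-(u t : ℂ)) * Complex.exp (-((t : ℂ) * Complex.I)) * Complex.I_sq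
  refine MeasureTheory.integral_Ioi_of_hasDerivAt_of_tendsto (hd x hx).continuousAt.continuousWithinAt
    (fun t ht => hd t (hx.trans ht)) ?_ h.lim
  refine (integrable_bound (|c| * (‖a‖ * Real.exp (|c| / x))) hx).mono' (h.forcing_meas hx) ?_
  filter_upwards [MeasureTheory.ae_restrict_mem measurableSet_Ioi] with t ht
  exact h.forcing_le hx (le_of_lt ht) le_rfl le_rfl

/-- A pointwise limit of solutions is a solution. -/
lemma sol_limit {c : ℕ → ℝ} {a : ℕ → ℂ} {u v : ℕ → ℝ → ℝ} {c0 : ℝ} {a0 : ℂ} {U : ℝ → ℝ}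
    (hs : ∀ i, Sol (c i) (a i) (u i) (v i)) (hc : Tendsto c atTop (𝓝 c0))
    (ha : Tendsto a atTop (𝓝 a0)) (hU : ∀ x, 0 < x → Tendsto (fun i => u i x) atTop (𝓝 (U x))) :
    ∃ V, Sol c0 a0 U V := by
  obtain ⟨C, hC⟩ : ∃ C, ∀ i, |c i| ≤ C := by
    obtain ⟨C, hC⟩ := hc.abs.bddAbove_range
    exact ⟨C, fun i => hC ⟨i, rfl⟩⟩
  obtain ⟨A, hA⟩ : ∃ A, ∀ i, ‖a i‖ ≤ A := by
    obtain ⟨C, hC⟩ := ha.norm.bddAbove_range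
    exact ⟨C, fun i => hC ⟨i, rfl⟩⟩
  set G := forcing c0 U with hG
  have hlim : ∀ t, 0 < t → Tendsto (fun i => forcing (c i) (u i) t) atTop (𝓝 (G t)) := by
    intro t ht
    have h1 := (hc.div_const (t ^ 2)).mul (hU t ht)
    exact ((Complex.continuous_ofReal.tendsto _).comp h1).mul_const _
  have hlimae : ∀ x, 0 < x → ∀ᵐ t ∂(MeasureTheory.volume.restrict (Ioi x)),
      Tendsto (fun i => forcing (c i) (u i) t) atTop (𝓝 (G t)) := by
    intro x hx
    filter_upwards [MeasureTheory.ae_restrict_mem measurableSet_Ioi] with t ht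
    exact hlim t (hx.trans ht)
  have hIntg : ∀ x, 0 < x → MeasureTheory.IntegrableOn G (Ioi x) := by
    intro x hx
    refine (integrable_bound (C * (A * Real.exp (C / x))) hx).mono'
      (aestronglyMeasurable_of_tendsto_ae atTop (fun i => (hs i).forcing_meas hx) (hlimae x hx)) ?_
    filter_upwards [MeasureTheory.ae_restrict_mem measurableSet_Ioi] with t ht
    exact le_of_tendsto (hlim t (hx.trans ht)).norm
      (Eventually.of_forall fun i => (hs i).forcing_le hx (le_of_lt ht) (hC i) (hA i))
  have hI : ∀ x, 0 < x → Tendsto (fun i => ∫ t in Ioi x, forcing (c i) (u i) t) atTop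
      (𝓝 (∫ t in Ioi x, G t)) := by
    intro x hx
    refine MeasureTheory.tendsto_integral_of_dominated_convergence
      (fun t => C * (A * Real.exp (C / x)) * t ^ (-2 : ℝ)) (fun i => (hs i).forcing_meas hx)
      (integrable_bound _ hx) (fun i => ?_) (hlimae x hx)
    filter_upwards [MeasureTheory.ae_restrict_mem measurableSet_Ioi] with t ht
    exact (hs i).forcing_le hx (le_of_lt ht) (hC i) (hA i)
  set Z : ℝ → ℂ := fun x => a0 - ∫ t in Ioi x, G t with hZ
  have hUZ : ∀ x, 0 < x → U x = (Z x * Complex.exp ((x : ℂ) * Complex.I)).im := by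
    intro x hx
    have h1 := (ha.sub (hI x hx)).mul_const (Complex.exp ((x : ℂ) * Complex.I))
    have h2 := (Complex.continuous_im.tendsto _).comp h1
    refine tendsto_nhds_unique (hU x hx) (h2.congr fun i => ?_)
    simp only [Function.comp]
    rw [(hs i).volterra hx, sub_sub_cancel, mul_assoc, ← Complex.exp_add, neg_add_cancel,
      Complex.exp_zero]
    simp
  have hZ1 : ∀ x₁ x, 0 < x₁ → 0 < x → Z x = Z x₁ + ∫ t in x₁..x, G t := by
    intro x₁ x h1 h2
    have := intervalIntegral.integral_interval_add_Ioi (hIntg x₁ h1) (hIntg x h2)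
    simp only [hZ]
    rw [← this]
    ring
  have hii : ∀ x₁ x, 0 < x₁ → 0 < x → IntervalIntegrable G MeasureTheory.volume x₁ x := by
    intro x₁ x h1 h2
    have h3 : 0 < min x₁ x / 2 := by positivity
    rw [intervalIntegrable_iff]
    refine (hIntg _ h3).mono_set fun t ht => ?_
    have := ht.1
    have h4 : 0 < min x₁ x := by positivity
    show min x₁ x / 2 < t
    linarith
  have hZc : ∀ x, 0 < x → ContinuousAt Z x := by
    intro x hx
    have h1 := intervalIntegral.continuousOn_primitive_interval'
      (hii (x / 2) (x + 1) (by linarith) (by linarith)) (left_mem_uIcc)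
    have h2 : ContinuousAt (fun b => ∫ t in (x / 2)..b, G t) x := by
      apply h1.continuousAt
      rw [uIcc_of_le (by linarith)]
      exact Icc_mem_nhds (by linarith) (by linarith)
    refine (h2.const_add (Z (x / 2))).congr ?_
    filter_upwards [lt_mem_nhds hx] with y hy
    exact (hZ1 _ _ (by linarith) hy).symm
  have hUc : ∀ x, 0 < x → ContinuousAt U x := by
    intro x hx
    have : ContinuousAt (fun x : ℝ => (Z x * Complex.exp ((x : ℂ) * Complex.I)).im) x :=
      Complex.continuous_im.continuousAt.comp ((hZc x hx).mul (by fun_prop))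
    refine this.congr ?_
    filter_upwards [lt_mem_nhds hx] with y hy
    exact (hUZ y hy).symm
  have hGc : ContinuousOn G (Ioi 0) :=
    fun t ht => (forcing_continuousAt ht (hUc t ht)).continuousWithinAt
  have hZd : ∀ x, 0 < x → HasDerivAt Z (G x) x := by
    intro x hx
    have h1 := intervalIntegral.integral_hasDerivAt_right (hii (x / 2) x (by linarith) hx)
      (hGc.stronglyMeasurableAtFilter isOpen_Ioi x hx) (forcing_continuousAt hx (hUc x hx))
    refine (h1.const_add (Z (x / 2))).congr_of_eventuallyEq ?_
    filter_upwards [lt_mem_nhds hx] with y hy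
    exact hZ1 _ _ (by linarith) hy
  have hE : ∀ x, 0 < x → HasDerivAt (fun x : ℝ => Z x * Complex.exp ((x : ℂ) * Complex.I))
      ((c0 / x ^ 2 * U x : ℝ) + Complex.I * (Z x * Complex.exp ((x : ℂ) * Complex.I))) x := by
    intro x hx
    have h2 : HasDerivAt (fun x : ℝ => Complex.exp ((x : ℂ) * Complex.I))
        (Complex.exp ((x : ℂ) * Complex.I) * (1 * Complex.I)) x := by
      have := (((hasDerivAt_id x).ofReal_comp).mul_const Complex.I).cexp
      simpa using this
    refine ((hZd x hx).mul h2).congr_deriv ?_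
    rw [hG, forcing, mul_assoc, ← Complex.exp_add, neg_add_cancel, Complex.exp_zero]
    ring
  refine ⟨fun x => (Z x * Complex.exp ((x : ℂ) * Complex.I)).re, ?_, ?_, ?_⟩
  · intro x hx
    have h1 := Complex.imCLM.hasFDerivAt.comp_hasDerivAt x (hE x hx)
    have h2 : HasDerivAt (fun x : ℝ => (Z x * Complex.exp ((x : ℂ) * Complex.I)).im)
      (Z x * Complex.exp ((x : ℂ) * Complex.I)).re x := by
      refine h1.congr_deriv ?_
      rw [Complex.imCLM_apply, Complex.add_im, Complex.ofReal_im, Complex.I_mul_im, zero_add]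
    refine h2.congr_of_eventuallyEq ?_
    filter_upwards [lt_mem_nhds hx] with y hy
    exact hUZ y hy
  · intro x hx
    have h1 := Complex.reCLM.hasFDerivAt.comp_hasDerivAt x (hE x hx)
    refine HasDerivAt.congr_deriv (f := fun x : ℝ => (Z x * Complex.exp ((x : ℂ) * Complex.I)).re) h1 ?_
    rw [Complex.reCLM_apply, Complex.add_re, Complex.ofReal_re, Complex.I_mul_re, ← hUZ x hx]
    ring
  · have h1 := MeasureTheory.intervalIntegral_tendsto_integral_Ioi 1 (hIntg 1 one_pos) tendsto_id
    have h2 := h1.const_add (Z 1)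
    have e : Z 1 + ∫ t in Ioi 1, G t = a0 := by simp [hZ]
    rw [e] at h2
    refine h2.congr' ?_
    filter_upwards [eventually_gt_atTop 0] with x hx
    rw [hUZ x hx, Complex.re_add_im, mul_assoc, ← Complex.exp_add, add_neg_cancel, Complex.exp_zero,
      mul_one]
    exact (hZ1 1 x one_pos hx).symm

/-- The complex amplitude of the cylinder function of order `ν`. -/
noncomputable def amp (θ : ℝ) : ℂ := (√(2 / π) : ℝ) * Complex.exp ((θ : ℝ) * Complex.I)

lemma sin_ne_zero_of_nonint {μ : ℝ} (hμ : ∀ n : ℤ, μ ≠ n) : Real.sin (μ * π) ≠ 0 := by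
  intro h
  obtain ⟨n, hn⟩ := Real.sin_eq_zero_iff.mp h
  exact hμ n (mul_right_cancel₀ Real.pi_ne_zero hn).symm

lemma sol_F {μ : ℝ} (hμ : ∀ n : ℤ, μ ≠ n) : Sol (μ ^ 2 - 1 / 4) (amp (π / 4 - μ * π / 2 - π / 2))
    (fun x => Real.cos (μ * π) / Real.sin (μ * π) * uJ μ x + -1 / Real.sin (μ * π) * uJ (-μ) x)
    (fun x => Real.cos (μ * π) / Real.sin (μ * π) * vJ μ x + -1 / Real.sin (μ * π) * vJ (-μ) x) := by
  have hs := sin_ne_zero_of_nonint hμ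
  have h2 := sol_J (-μ)
  rw [neg_sq] at h2
  have h := (sol_J μ).lincomb h2 (Real.cos (μ * π) / Real.sin (μ * π)) (-1 / Real.sin (μ * π))
  convert h using 1
  have e1 : Complex.exp ((π / 4 - -μ * π / 2 : ℝ) * Complex.I) =
      Complex.exp ((π / 4 - μ * π / 2 : ℝ) * Complex.I) *
      (Complex.cos ((μ * π : ℝ) : ℂ) + Complex.sin ((μ * π : ℝ) : ℂ) * Complex.I) := by
    rw [← Complex.exp_mul_I, ← Complex.exp_add]
    congr 1
    push_cast
    ring
  have e2 : Complex.exp ((π / 4 - μ * π / 2 - π / 2 : ℝ) * Complex.I) =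
      Complex.exp ((π / 4 - μ * π / 2 : ℝ) * Complex.I) * -Complex.I := by
    rw [← Complex.exp_neg_pi_div_two_mul_I, ← Complex.exp_add]
    congr 1
    push_cast
    ring
  rw [amp, e1, e2]
  have hs' : Complex.sin (μ * π) ≠ 0 := by
    have : ((Real.sin (μ * π) : ℝ) : ℂ) ≠ 0 := by exact_mod_cast hs
    push_cast at this
    exact this
  push_cast
  generalize Complex.sin (μ * π) = s at *
  generalize Complex.cos (μ * π) = k at *
  field_simp
  ring

lemma tendsto_Y {ν x : ℝ} (hν : 0 < ν) (hx : 0 < x) :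
    Tendsto (fun μ : ℝ => (besselJ μ x * Real.cos (μ * π) - besselJ (-μ) x) / Real.sin (μ * π))
      (𝓝[{μ : ℝ | ∀ n : ℤ, μ ≠ (n : ℝ)}] ν) (𝓝 (besselY ν x)) := by
  apply tendsto_nhds_limUnder
  have hN : Differentiable ℝ (fun μ : ℝ => besselJ μ x * Real.cos (μ * π) - besselJ (-μ) x) := by
    have h1 := besselJ_differentiable_order x hx
    have h2 : Differentiable ℝ (fun μ : ℝ => besselJ (-μ) x) := h1.comp differentiable_neg
    exact (h1.mul (by fun_prop)).sub h2
  have hD : Differentiable ℝ (fun μ : ℝ => Real.sin (μ * π)) := by fun_prop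
  by_cases hIntg : ∃ n : ℤ, ν = n
  · obtain ⟨n, rfl⟩ := hIntg
    have hn : 0 < n := by exact_mod_cast hν
    lift n to ℕ using hn.le
    have hN0 : besselJ ((n : ℤ) : ℝ) x * Real.cos ((n : ℤ) * π) - besselJ (-((n : ℤ) : ℝ)) x = 0 := by
      push_cast
      rw [besselJ_neg_nat n x hx, Real.cos_nat_mul_pi]
      ring
    have hD0 : Real.sin (((n : ℤ) : ℝ) * π) = 0 := Real.sin_int_mul_pi _
    have hle : 𝓝[{μ : ℝ | ∀ n : ℤ, μ ≠ (n : ℝ)}] ((n : ℤ) : ℝ) ≤ 𝓝[≠] ((n : ℤ) : ℝ) :=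
      nhdsWithin_mono _ fun μ hμ => hμ n
    have h1 := (hN ((n : ℤ) : ℝ)).hasDerivAt.tendsto_slope.mono_left hle
    have hd : HasDerivAt (fun μ : ℝ => Real.sin (μ * π)) (Real.cos (((n : ℤ) : ℝ) * π) * π) ((n : ℤ) : ℝ) := by
      have := ((hasDerivAt_id ((n : ℤ) : ℝ)).mul_const π).sin
      simpa using this
    have h2 := hd.tendsto_slope.mono_left hle
    have hne : Real.cos (((n : ℤ) : ℝ) * π) * π ≠ 0 := by
      apply mul_ne_zero _ Real.pi_ne_zero
      intro h
      have := Real.sin_sq_add_cos_sq (((n : ℤ) : ℝ) * π)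
      rw [hD0, h] at this
      norm_num at this
    refine ⟨_, (h1.div h2 hne).congr' ?_⟩
    filter_upwards [self_mem_nhdsWithin] with μ hμ
    have hs := sin_ne_zero_of_nonint hμ
    have hm : μ - ((n : ℤ) : ℝ) ≠ 0 := sub_ne_zero.mpr (hμ n)
    simp only [Pi.div_apply, slope_def_field]
    rw [hN0, hD0]
    field_simp
    simp
  · push Not at hIntg
    refine ⟨(besselJ ν x * Real.cos (ν * π) - besselJ (-ν) x) / Real.sin (ν * π),
      Tendsto.mono_left ?_ nhdsWithin_le_nhds⟩
    exact ((hN ν).continuousAt.div (hD ν).continuousAt (sin_ne_zero_of_nonint hIntg)).tendsto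

lemma sol_Y {ν : ℝ} (hν : 0 < ν) : ∃ V, Sol (ν ^ 2 - 1 / 4) (amp (π / 4 - ν * π / 2 - π / 2))
    (fun x => √x * besselY ν x) V := by
  have hd : ν ∈ closure {μ : ℝ | ∀ n : ℤ, μ ≠ (n : ℝ)} := by
    have h1 : Dense (Set.range (fun n : ℤ => (n : ℝ)))ᶜ := (countable_range _).dense_compl ℝ
    have h2 : (Set.range (fun n : ℤ => (n : ℝ)))ᶜ = {μ : ℝ | ∀ n : ℤ, μ ≠ (n : ℝ)} := by
      ext μ
      simp [eq_comm]
    rw [← h2]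
    exact h1 ν
  obtain ⟨m, hm, hlim⟩ := mem_closure_iff_seq_limit.mp hd
  refine sol_limit (fun i => sol_F (hm i)) ((hlim.pow 2).sub_const _) ?_ ?_
  · have : Continuous fun μ : ℝ => amp (π / 4 - μ * π / 2 - π / 2) := by
      unfold amp
      fun_prop
    exact (this.tendsto ν).comp hlim
  · intro x hx
    have h1 : Tendsto m atTop (𝓝[{μ : ℝ | ∀ n : ℤ, μ ≠ (n : ℝ)}] ν) :=
      tendsto_nhdsWithin_iff.mpr ⟨hlim, Eventually.of_forall hm⟩
    refine (((tendsto_Y hν hx).comp h1).const_mul (√x)).congr fun i => ?_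
    simp only [Function.comp, uJ]
    ring

lemma sol_C (δ : ℝ) {ν : ℝ} (hν : 0 < ν) : ∃ V, Sol (ν ^ 2 - 1 / 4) (amp (π / 4 - ν * π / 2 + δ))
    (fun x => √x * cylinder δ ν x) V := by
  obtain ⟨V, hV⟩ := sol_Y hν
  have h := (sol_J ν).lincomb hV (Real.cos δ) (-Real.sin δ)
  refine ⟨fun x => Real.cos δ * vJ ν x + -Real.sin δ * V x, ?_⟩
  · convert h using 1
    · have e2 : Complex.exp ((π / 4 - ν * π / 2 - π / 2 : ℝ) * Complex.I) =
          Complex.exp ((π / 4 - ν * π / 2 : ℝ) * Complex.I) * -Complex.I := by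
        rw [← Complex.exp_neg_pi_div_two_mul_I, ← Complex.exp_add]
        congr 1
        push_cast
        ring
      have e1 : Complex.exp ((π / 4 - ν * π / 2 + δ : ℝ) * Complex.I) =
          Complex.exp ((π / 4 - ν * π / 2 : ℝ) * Complex.I) *
          (Complex.cos (δ : ℂ) + Complex.sin (δ : ℂ) * Complex.I) := by
        rw [← Complex.exp_mul_I, ← Complex.exp_add]
        congr 1
        push_cast
        ring
      rw [amp, amp, e1, e2]
      push_cast
      ring
    · ext x
      simp only [cylinder, uJ]
      ring

lemma phi_tendsto_zero (ν : ℝ) : Tendsto (fun x : ℝ => phi ν ((x / 2) ^ 2)) (𝓝 0)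
    (𝓝 (Real.Gamma (ν + 1))⁻¹) := by
  have h1 : ContinuousAt (fun t => phi ν t) 0 := (phi_hasDerivAt ν 0).continuousAt
  have h2 : Tendsto (fun x : ℝ => (x / 2) ^ 2) (𝓝 0) (𝓝 0) := by
    have : Continuous fun x : ℝ => (x / 2) ^ 2 := by fun_prop
    simpa using this.tendsto 0
  rw [← phi_zero]
  exact h1.tendsto.comp h2

lemma phi_zero_pos {ν : ℝ} (hν : 0 < ν) : 0 < (Real.Gamma (ν + 1))⁻¹ :=
  inv_pos.mpr (Real.Gamma_pos_of_pos (by linarith))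

lemma uJ_near {ν : ℝ} (hν : 0 < ν) : ∃ x₀ M, 0 < x₀ ∧ 0 < M ∧
    ∀ x, 0 < x → x < x₀ → 0 < uJ ν x ∧ uJ ν x ≤ M * √x := by
  have h1 := (phi_tendsto_zero ν).eventually (lt_mem_nhds (phi_zero_pos hν))
  have h2 := (phi_tendsto_zero ν).eventually (gt_mem_nhds (lt_add_one (Real.Gamma (ν + 1))⁻¹))
  obtain ⟨ε, hε, h⟩ := Metric.eventually_nhds_iff.mp (h1.and h2)
  refine ⟨min ε 2, (Real.Gamma (ν + 1))⁻¹ + 1, by positivity,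
    by have := phi_zero_pos hν; positivity, fun x hx hx' => ?_⟩
  have h3 := h (y := x) (by
    rw [Real.dist_eq, sub_zero, abs_of_pos hx]
    exact hx'.trans_le (min_le_left _ _))
  have hx2 : x / 2 ≤ 1 := by
    have := hx'.trans_le (min_le_right ε 2)
    linarith
  rw [uJ, besselJ_eq _ _ hx]
  have h4 : (x / 2) ^ ν ≤ 1 := Real.rpow_le_one (by positivity) hx2 hν.le
  have h5 : 0 < (x / 2) ^ ν := by positivity
  have h6 : 0 < √x := Real.sqrt_pos.mpr hx
  refine ⟨by have := h3.1; positivity, ?_⟩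
  have : (x / 2) ^ ν * phi ν ((x / 2) ^ 2) ≤ 1 * ((Real.Gamma (ν + 1))⁻¹ + 1) :=
    mul_le_mul h4 h3.2.le h3.1.le zero_le_one
  nlinarith

lemma wronsk_near {ν μ : ℝ} (hμ : 0 < μ) (h : μ < ν) : ∃ x₀, 0 < x₀ ∧
    ∀ x, 0 < x → x < x₀ → 0 < uJ μ x * vJ ν x - uJ ν x * vJ μ x := by
  have h0 : Tendsto (fun x : ℝ => x * (x / 2)) (𝓝 0) (𝓝 0) := by
    have : Continuous fun x : ℝ => x * (x / 2) := by fun_prop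
    simpa using this.tendsto 0
  have h1 := (((phi_tendsto_zero ν).mul (phi_tendsto_zero μ)).const_mul (ν - μ)).sub
    (h0.mul (((phi_tendsto_zero μ).mul (phi_tendsto_zero (ν + 1))).sub
      ((phi_tendsto_zero ν).mul (phi_tendsto_zero (μ + 1)))))
  rw [zero_mul, sub_zero] at h1
  have hp : 0 < (ν - μ) * ((Real.Gamma (ν + 1))⁻¹ * (Real.Gamma (μ + 1))⁻¹) :=
    mul_pos (by linarith) (mul_pos (phi_zero_pos (by linarith)) (phi_zero_pos hμ))
  obtain ⟨ε, hε, h2⟩ := Metric.eventually_nhds_iff.mp (h1.eventually (lt_mem_nhds hp))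
  refine ⟨ε, hε, fun x hx hx' => ?_⟩
  have h3 := h2 (y := x) (by rwa [Real.dist_eq, sub_zero, abs_of_pos hx])
  have hx2 : 0 < x / 2 := by positivity
  have e : uJ μ x * vJ ν x - uJ ν x * vJ μ x = (x / 2) ^ ν * (x / 2) ^ μ *
      ((ν - μ) * (phi ν ((x / 2) ^ 2) * phi μ ((x / 2) ^ 2)) - x * (x / 2) *
        (phi μ ((x / 2) ^ 2) * phi (ν + 1) ((x / 2) ^ 2) -
          phi ν ((x / 2) ^ 2) * phi (μ + 1) ((x / 2) ^ 2))) := by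
    simp only [uJ, vJ, besselJ_eq _ _ hx]
    rw [Real.rpow_add hx2, Real.rpow_add hx2, Real.rpow_one]
    have hs : √x * √x = x := Real.mul_self_sqrt hx.le
    generalize phi ν ((x / 2) ^ 2) = p1
    generalize phi μ ((x / 2) ^ 2) = p2
    generalize phi (ν + 1) ((x / 2) ^ 2) = p3
    generalize phi (μ + 1) ((x / 2) ^ 2) = p4
    generalize (x / 2) ^ ν = q1
    generalize (x / 2) ^ μ = q2
    have : √x * (q2 * p2) * (√x * ((ν + 1 / 2) / x * (q1 * p1) - q1 * (x / 2) * p3)) -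
        √x * (q1 * p1) * (√x * ((μ + 1 / 2) / x * (q2 * p2) - q2 * (x / 2) * p4)) =
        (√x * √x) * ((q2 * p2) * (((ν + 1 / 2) / x * (q1 * p1) - q1 * (x / 2) * p3)) -
        (q1 * p1) * (((μ + 1 / 2) / x * (q2 * p2) - q2 * (x / 2) * p4))) := by ring
    rw [this, hs]
    field_simp
    ring
  rw [e]
  exact mul_pos (by positivity) h3

/-- Standard Prüfer angle: it starts in `(0, π)` and is asymptotic to `x + L`. -/
structure StdAngle (c L : ℝ) (u v γ R : ℝ → ℝ) : Prop where
  ang : PAngle c u v γ R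
  near : ∃ x₀, 0 < x₀ ∧ ∀ x, 0 < x → x < x₀ → 0 < γ x ∧ γ x < π
  lim : Tendsto (fun x => γ x - x) atTop (𝓝 L)

lemma amp_pos : 0 < √(2 / π) := Real.sqrt_pos.mpr (by positivity)

lemma amp_ne (θ : ℝ) : amp θ ≠ 0 := by
  rw [amp]
  exact mul_ne_zero (by exact_mod_cast amp_pos.ne') (Complex.exp_ne_zero _)

lemma std_exists {c θ x₀ : ℝ} {u v : ℝ → ℝ} (h : Sol c (amp θ) u v) (hx₀ : 0 < x₀)
    (hpos : ∀ x, 0 < x → x < x₀ → 0 < u x) :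
    ∃ (γ R : ℝ → ℝ) (k : ℤ), StdAngle c (θ + k * (2 * π)) u v γ R := by
  obtain ⟨γ, R, hγ⟩ := h.exists_angle (amp_ne θ)
  obtain ⟨k, hk⟩ := hγ.near_zero hx₀ hpos
  obtain ⟨j, hj⟩ := (hγ.shift k).tendsto amp_pos h
  exact ⟨_, R, j, hγ.shift k, ⟨x₀, hx₀, hk⟩, hj⟩

lemma std_J {ν : ℝ} (hν : 0 < ν) : ∃ (γ R : ℝ → ℝ) (k : ℤ),
    StdAngle (ν ^ 2 - 1 / 4) (π / 4 - ν * π / 2 + k * (2 * π)) (uJ ν) (vJ ν) γ R := by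
  obtain ⟨x₀, M, h0, -, h⟩ := uJ_near hν
  exact std_exists (sol_J ν) h0 fun x hx hx' => (h x hx hx').1

lemma pos_of_sin_pos {d : ℝ} (h1 : -π < d) (h : 0 < Real.sin d) : 0 < d := by
  by_contra hn
  have := Real.sin_nonpos_of_nonpos_of_neg_pi_le (not_lt.mp hn) h1.le
  linarith

lemma J_limits {ν μ L L' : ℝ} (hμ : 0 < μ) (h : μ < ν) {γ R γ' R' : ℝ → ℝ}
    (h1 : StdAngle (ν ^ 2 - 1 / 4) L (uJ ν) (vJ ν) γ R)
    (h2 : StdAngle (μ ^ 2 - 1 / 4) L' (uJ μ) (vJ μ) γ' R') : L ≤ L' := by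
  obtain ⟨x₀, hx₀, hw⟩ := wronsk_near hμ h
  obtain ⟨x₁, hx₁, hn1⟩ := h1.near
  obtain ⟨x₂, hx₂, hn2⟩ := h2.near
  have hm : 0 < min x₀ (min x₁ x₂) := by positivity
  obtain ⟨x, hx, hxm⟩ := exists_between hm
  have a0 : x < x₀ := hxm.trans_le (min_le_left _ _)
  have a1 : x < x₁ := hxm.trans_le ((min_le_right _ _).trans (min_le_left _ _))
  have a2 : x < x₂ := hxm.trans_le ((min_le_right _ _).trans (min_le_right _ _))
  have k0 := hw x hx a0
  have k1 := hn1 x hx a1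
  have k2 := hn2 x hx a2
  have hlt : γ x < γ' x := by
    rw [h1.ang.hu x hx, h1.ang.hv x hx, h2.ang.hu x hx, h2.ang.hv x hx] at k0
    have e : R' x * Real.sin (γ' x) * (R x * Real.cos (γ x)) -
        R x * Real.sin (γ x) * (R' x * Real.cos (γ' x)) = R x * R' x * Real.sin (γ' x - γ x) := by
      rw [Real.sin_sub]; ring
    rw [e] at k0
    have hRR : 0 < R x * R' x := mul_pos (h1.ang.pos x hx) (h2.ang.pos x hx)
    have := pos_of_sin_pos (by linarith [k1.2, k2.1]) ((pos_iff_pos_of_mul_pos k0).mp hRR)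
    linarith
  refine le_of_tendsto_of_tendsto h1.lim h2.lim ?_
  filter_upwards [eventually_ge_atTop x] with y hy
  have := h2.ang.compare h1.ang (by nlinarith) hx hy hlt
  linarith

lemma C_pos_near {δ ν : ℝ} (hν : 0 < ν) (hδ : 0 < δ) (hδ' : δ < π) {V : ℝ → ℝ}
    (hs : Sol (ν ^ 2 - 1 / 4) (amp (π / 4 - ν * π / 2 + δ)) (fun x => √x * cylinder δ ν x) V) :
    (∃ κ, 0 < κ ∧ ∀ x, 0 < x → √x * cylinder δ ν x * vJ ν x - V x * uJ ν x = κ) ∧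
    ∃ x₀, 0 < x₀ ∧ ∀ x, 0 < x → x < x₀ → 0 < √x * cylinder δ ν x := by
  have hsin : 0 < Real.sin δ := Real.sin_pos_of_pos_of_lt_pi hδ hδ'
  set κ : ℝ := 2 / π * Real.sin δ with hκ
  have hκ0 : 0 < κ := by positivity
  have hJ := sol_J ν
  have hw : ∀ x, 0 < x → √x * cylinder δ ν x * vJ ν x - V x * uJ ν x = κ := by
    intro x hx
    have h1 := wronskian_const hs hJ x hx
    have e : (starRingEnd ℂ) (amp (π / 4 - ν * π / 2 + δ)) *
        ((√(2 / π) : ℝ) * Complex.exp ((π / 4 - ν * π / 2 : ℝ) * Complex.I)) =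
        ((2 / π : ℝ) : ℂ) * Complex.exp ((-δ : ℝ) * Complex.I) := by
      rw [amp, map_mul, Complex.conj_ofReal, ← Complex.exp_conj, map_mul, Complex.conj_ofReal,
        Complex.conj_I]
      have e1 : ((2 / π : ℝ) : ℂ) = (√(2 / π) : ℝ) * (√(2 / π) : ℝ) := by
        rw [← Complex.ofReal_mul, Real.mul_self_sqrt (by positivity)]
      have e2 : Complex.exp ((-δ : ℝ) * Complex.I) =
          Complex.exp ((π / 4 - ν * π / 2 + δ : ℝ) * -Complex.I) *
          Complex.exp ((π / 4 - ν * π / 2 : ℝ) * Complex.I) := by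
        rw [← Complex.exp_add]
        congr 1
        push_cast
        ring
      rw [e1, e2]
      ring
    rw [e, Complex.im_ofReal_mul, Complex.exp_ofReal_mul_I_im, Real.sin_neg] at h1
    rw [hκ]
    linarith
  refine ⟨⟨κ, hκ0, hw⟩, ?_⟩
  obtain ⟨x₀, M, hx₀, hM, hn⟩ := uJ_near hν
  set K := κ / M ^ 2 with hK
  have hK0 : 0 < K := by positivity
  set r : ℝ → ℝ := fun x => √x * cylinder δ ν x / uJ ν x + K * Real.log x with hr
  have hd : ∀ x ∈ Ioo 0 x₀, HasDerivAt r (-κ / uJ ν x ^ 2 + K * x⁻¹) x := by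
    intro x hx
    have hp := (hn x hx.1 hx.2).1
    refine (((hs.du x hx.1).div (hJ.du x hx.1) hp.ne').add
      ((Real.hasDerivAt_log hx.1.ne').const_mul K)).congr_deriv ?_
    rw [← hw x hx.1]
    ring
  have hanti : AntitoneOn r (Ioo 0 x₀) := by
    apply antitoneOn_of_deriv_nonpos (convex_Ioo 0 x₀)
    · exact fun y hy => (hd y hy).continuousAt.continuousWithinAt
    · rw [interior_Ioo]
      exact fun y hy => (hd y hy).differentiableAt.differentiableWithinAt
    · rw [interior_Ioo]
      intro y hy
      rw [(hd y hy).deriv]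
      obtain ⟨hp, hle⟩ := hn y hy.1 hy.2
      have h1 : uJ ν y ^ 2 ≤ M ^ 2 * y := by
        calc uJ ν y ^ 2 ≤ (M * √y) ^ 2 := by gcongr
          _ = M ^ 2 * y := by rw [mul_pow, Real.sq_sqrt hy.1.le]
      have h2 : κ / (M ^ 2 * y) ≤ κ / uJ ν y ^ 2 := by gcongr
      have h3 : K * y⁻¹ = κ / (M ^ 2 * y) := by
        rw [hK]
        have := hy.1
        field_simp
      rw [h3, neg_div]
      linarith
  have hx1 : x₀ / 2 ∈ Ioo 0 x₀ := ⟨by linarith, by linarith⟩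
  refine ⟨min (x₀ / 2) (Real.exp (r (x₀ / 2) / K)), by positivity, fun x hx hx' => ?_⟩
  have a1 : x < x₀ / 2 := hx'.trans_le (min_le_left _ _)
  have a2 : x < Real.exp (r (x₀ / 2) / K) := hx'.trans_le (min_le_right _ _)
  have hxm : x ∈ Ioo 0 x₀ := ⟨hx, by linarith⟩
  have h1 := hanti hxm hx1 a1.le
  have h2 : Real.log x < r (x₀ / 2) / K := (Real.log_lt_iff_lt_exp hx).mpr a2
  have h3 : K * Real.log x < r (x₀ / 2) := by
    rw [lt_div_iff₀ hK0] at h2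
    linarith
  have h4 : 0 < √x * cylinder δ ν x / uJ ν x := by
    have : r x = √x * cylinder δ ν x / uJ ν x + K * Real.log x := rfl
    linarith
  exact (div_pos_iff_of_pos_right (hn x hx hxm.2).1).mp h4

lemma std_C {δ ν : ℝ} (hν : 0 < ν) (hδ : 0 ≤ δ) (hδ' : δ < π) {γ R : ℝ → ℝ} {k : ℤ}
    (h : StdAngle (ν ^ 2 - 1 / 4) (π / 4 - ν * π / 2 + k * (2 * π)) (uJ ν) (vJ ν) γ R) :
    ∃ V γ' R' : ℝ → ℝ, StdAngle (ν ^ 2 - 1 / 4) (π / 4 - ν * π / 2 + k * (2 * π) + δ)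
      (fun x => √x * cylinder δ ν x) V γ' R' := by
  rcases hδ.eq_or_lt with rfl | hδ0
  · refine ⟨vJ ν, γ, R, ?_⟩
    have : (fun x => √x * cylinder 0 ν x) = uJ ν := by
      ext x
      simp [cylinder, uJ]
    rw [this, add_zero]
    exact h
  obtain ⟨V, hV⟩ := sol_C δ hν
  obtain ⟨⟨κ, hκ, hw⟩, x₀, hx₀, hpos⟩ := C_pos_near hν hδ0 hδ' hV
  obtain ⟨γ', R', j, h'⟩ := std_exists hV hx₀ hpos
  obtain ⟨x₁, hx₁, hn1⟩ := h.near
  obtain ⟨x₂, hx₂, hn2⟩ := h'.near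
  have hsin : ∀ x, 0 < x → 0 < Real.sin (γ' x - γ x) := by
    intro x hx
    have k0 := hw x hx
    have hu' := h'.ang.hu x hx
    rw [hu', h'.ang.hv x hx, h.ang.hu x hx, h.ang.hv x hx] at k0
    have e : R' x * Real.sin (γ' x) * (R x * Real.cos (γ x)) -
        R' x * Real.cos (γ' x) * (R x * Real.sin (γ x)) = R x * R' x * Real.sin (γ' x - γ x) := by
      rw [Real.sin_sub]; ring
    rw [e] at k0
    have hRR : 0 < R x * R' x := mul_pos (h.ang.pos x hx) (h'.ang.pos x hx)
    rw [← k0] at hκ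
    exact (pos_iff_pos_of_mul_pos hκ).mp hRR
  obtain ⟨x, hx, hxm⟩ := exists_between (show 0 < min x₁ x₂ by positivity)
  have k1 := hn1 x hx (hxm.trans_le (min_le_left _ _))
  have k2 := hn2 x hx (hxm.trans_le (min_le_right _ _))
  have b1 : 0 < γ' x - γ x := pos_of_sin_pos (by linarith [k1.2, k2.1]) (hsin x hx)
  have b2 : γ' x - γ x < π := by linarith [k1.1, k2.2]
  have hc : ContinuousOn (fun x => γ' x - γ x) (Ioi 0) := h'.ang.cont.sub h.ang.cont
  have g1 := stay_gt isPreconnected_Ioi hc (p := 0) (fun y hy he => by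
    have := hsin y hy
    rw [he, Real.sin_zero] at this
    exact lt_irrefl _ this) hx b1
  have g2 := stay_lt isPreconnected_Ioi hc (p := π) (fun y hy he => by
    have := hsin y hy
    rw [he, Real.sin_pi] at this
    exact lt_irrefl _ this) hx b2
  have hl := h'.lim.sub h.lim
  have l1 := ge_of_tendsto hl (b := 0) (by
    filter_upwards [eventually_gt_atTop 0] with y hy
    have := g1 y hy
    linarith)
  have l2 := le_of_tendsto hl (b := π) (by
    filter_upwards [eventually_gt_atTop 0] with y hy
    have := g2 y hy
    linarith)
  have hπ := Real.pi_pos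
  have hjk : j = k := by
    have c1 : (-1 : ℝ) < (j - k : ℤ) := by push_cast; nlinarith
    have c2 : ((j - k : ℤ) : ℝ) < 1 := by push_cast; nlinarith
    have c1' : -1 < j - k := by exact_mod_cast c1
    have c2' : j - k < 1 := by exact_mod_cast c2
    omega
  subst hjk
  refine ⟨V, γ', R', ?_⟩
  rw [show π / 4 - ν * π / 2 + j * (2 * π) + δ = π / 4 - ν * π / 2 + δ + j * (2 * π) by ring]
  exact h'

lemma J_step {ν μ : ℝ} (hμ : 0 < μ) (h : μ < ν) (h4 : ν - μ < 4) {γ R γ' R' : ℝ → ℝ} {k j : ℤ}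
    (h1 : StdAngle (ν ^ 2 - 1 / 4) (π / 4 - ν * π / 2 + k * (2 * π)) (uJ ν) (vJ ν) γ R)
    (h2 : StdAngle (μ ^ 2 - 1 / 4) (π / 4 - μ * π / 2 + j * (2 * π)) (uJ μ) (vJ μ) γ' R') :
    k ≤ j := by
  have hl := J_limits hμ h h1 h2
  have hπ := Real.pi_pos
  have c2 : ((k - j : ℤ) : ℝ) < 1 := by push_cast; nlinarith
  have c2' : k - j < 1 := by exact_mod_cast c2
  omega

lemma J_gap {ν μ : ℝ} (hμ : 0 < μ) (h : μ + 2 < ν) {γ R γ' R' : ℝ → ℝ} {k j : ℤ}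
    (h1 : StdAngle (ν ^ 2 - 1 / 4) (π / 4 - ν * π / 2 + k * (2 * π)) (uJ ν) (vJ ν) γ R)
    (h2 : StdAngle (μ ^ 2 - 1 / 4) (π / 4 - μ * π / 2 + j * (2 * π)) (uJ μ) (vJ μ) γ' R') :
    π < (π / 4 - μ * π / 2 + j * (2 * π)) - (π / 4 - ν * π / 2 + k * (2 * π)) := by
  have hπ := Real.pi_pos
  by_cases h4 : ν - μ < 4
  · have := J_step hμ (by linarith) h4 h1 h2
    have c : (k : ℝ) ≤ j := by exact_mod_cast this
    nlinarith
  · obtain ⟨γ'', R'', i, h3⟩ := std_J (ν := μ + 3) (by linarith)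
    have b1 := J_limits (by linarith) (by linarith : μ + 3 < ν) h1 h3
    have := J_step hμ (by linarith) (by linarith) h3 h2
    have c : (i : ℝ) ≤ j := by exact_mod_cast this
    nlinarith

lemma interlaceHalf_congr {f g f' g' : ℝ → ℝ} (hf : ∀ x, 0 < x → (f x = 0 ↔ f' x = 0))
    (hg : ∀ x, 0 < x → (g x = 0 ↔ g' x = 0)) (h : InterlaceHalf f g (Ioi 0)) :
    InterlaceHalf f' g' (Ioi 0) := by
  intro x₁ h1 x₂ h2 hlt z1 z2 hno
  obtain ⟨x, ⟨hx, hgx⟩, hu⟩ := h x₁ h1 x₂ h2 hlt ((hf _ h1).mpr z1) ((hf _ h2).mpr z2)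
    (fun x hx he => hno x hx ((hf x (lt_trans h1 hx.1)).mp he))
  refine ⟨x, ⟨hx, (hg x (lt_trans h1 hx.1)).mp hgx⟩, ?_⟩
  rintro y ⟨hy, hgy⟩
  exact hu y ⟨hy, (hg y (lt_trans h1 hy.1)).mpr hgy⟩

lemma cylinder_zero_iff (δ ν x : ℝ) (hx : 0 < x) :
    cylinder δ ν x = 0 ↔ √x * cylinder (δ - ⌊δ / π⌋ * π) ν x = 0 := by
  have h6 : √x ≠ 0 := (Real.sqrt_pos.mpr hx).ne'
  rw [mul_eq_zero, or_iff_right h6, cylinder, cylinder, Real.cos_sub_int_mul_pi,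
    Real.sin_sub_int_mul_pi]
  have e : ∀ s : ℝ, s * Real.cos δ * besselJ ν x - s * Real.sin δ * besselY ν x =
      s * (Real.cos δ * besselJ ν x - Real.sin δ * besselY ν x) := fun s => by ring
  rw [e, mul_eq_zero, or_iff_right]
  exact zpow_ne_zero _ (by norm_num)

lemma main_half (δ : ℝ) {ν μ : ℝ} (hμ : 0 < μ) (h : μ + 2 < ν) :
    ¬ InterlaceHalf (cylinder δ μ) (cylinder δ ν) (Ioi 0) := by
  intro hI
  have hπ := Real.pi_pos
  set δ' := δ - ⌊δ / π⌋ * π with hδ'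
  have d0 : 0 ≤ δ' := by
    have := Int.floor_le (δ / π)
    rw [le_div_iff₀ hπ] at this
    linarith
  have d1 : δ' < π := by
    have := Int.lt_floor_add_one (δ / π)
    rw [div_lt_iff₀ hπ] at this
    linarith
  obtain ⟨γ, R, k, h1⟩ := std_J (ν := ν) (by linarith)
  obtain ⟨γ', R', j, h2⟩ := std_J hμ
  have hgap := J_gap hμ h h1 h2
  obtain ⟨V, γ₁, R₁, s1⟩ := std_C (by linarith) d0 d1 h1
  obtain ⟨V', γ₂, R₂, s2⟩ := std_C hμ d0 d1 h2
  obtain ⟨x₁, hx₁, hn1⟩ := s1.near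
  obtain ⟨x₂, hx₂, hn2⟩ := s2.near
  refine not_interlaceHalf s2.ang s1.ang hx₂ hx₁ hn2 hn1 s2.lim s1.lim (by linarith) ?_
  exact interlaceHalf_congr (cylinder_zero_iff δ μ) (cylinder_zero_iff δ ν) hI

/-- For `ν, μ > 0` with `|ν − μ| > 2`, the positive zeros of the cylinder functions
`C_ν` and `C_μ` are not interlaced on `(0,∞)`. -/
theorem cylinder_not_interlaced (δ ν μ : ℝ) (hν : 0 < ν) (hμ : 0 < μ)
    (hsep : 2 < |ν - μ|) :
    ¬ InterlacedOn (cylinder δ ν) (cylinder δ μ) (Set.Ioi 0) := by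
  rintro ⟨h1, h2⟩
  rcases lt_abs.mp hsep with h | h
  · exact main_half δ hμ (by linarith) h2
  · exact main_half δ hν (by linarith) h1
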